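/- Suppose the trace parameters are specialized to complex numbers (x_1, …, x_{d−1}) satisfying the E-condition and (y_0, …, y_{d−1}) satisfying the F-condition with respect to the x's. Then for every n ≥ 1 and every w ∈ Y_{d,n}^B, Tr_{n+1}(w e_n) = Tr_n(w)·Tr_{n+1}(e_n). -/

import Mathlib

set_option maxHeartbeats 1000000
set_option synthInstance.maxHeartbeats 400000

noncomputable section

/-- The field `L = ℂ(u,v,z)` of rational functions in three indeterminates over `ℂ`. -/
abbrev Kf : Type := FractionRing (MvPolynomial (Fin 3) ℂ)

/-- The indeterminate `u`. -/
def uu : Kf := algebraMap (MvPolynomial (Fin 3) ℂ) Kf (MvPolynomial.X 0)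

/-- The indeterminate `v`. -/
def vv : Kf := algebraMap (MvPolynomial (Fin 3) ℂ) Kf (MvPolynomial.X 1)

/-- The indeterminate `z`. -/
def zz : Kf := algebraMap (MvPolynomial (Fin 3) ℂ) Kf (MvPolynomial.X 2)

/-- Generators of the framization of the Hecke algebra of type B on `n` strands:
`b` is the generator `b₁`, `g i` is the braiding generator `g_{i+1}` (`i : Fin (n-1)`),
and `t j` is the framing generator `t_{j+1}` (`j : Fin n`). -/
inductive Gen (n : ℕ) : Type
  | b : Gen n
  | g : Fin (n - 1) → Gen n
  | t : Fin n → Gen n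

/-- The free algebra on the generators. -/
abbrev FA (n : ℕ) : Type := FreeAlgebra Kf (Gen n)

/-- The generator `b₁` in the free algebra. -/
def Bb (n : ℕ) : FA n := FreeAlgebra.ι Kf Gen.b

/-- The generator `g_i` (for `1 ≤ i ≤ n-1`) in the free algebra; junk value `1` out of range. -/
def Gg (n i : ℕ) : FA n :=
  if h : 1 ≤ i ∧ i ≤ n - 1 then FreeAlgebra.ι Kf (Gen.g ⟨i - 1, by omega⟩) else 1

/-- The generator `t_j` (for `1 ≤ j ≤ n`) in the free algebra; junk value `1` out of range. -/
def Tt (n j : ℕ) : FA n :=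
  if h : 1 ≤ j ∧ j ≤ n then FreeAlgebra.ι Kf (Gen.t ⟨j - 1, by omega⟩) else 1

/-- The element `e_i = (1/d) ∑_{m=0}^{d-1} t_i^m t_{i+1}^{d-m}` in the free algebra. -/
def eF (d n i : ℕ) : FA n :=
  (d : Kf)⁻¹ • ∑ m ∈ Finset.range d, Tt n i ^ m * Tt n (i + 1) ^ (d - m)

/-- The element `f₁ = (1/d) ∑_{m=0}^{d-1} t₁^m` in the free algebra. -/
def fF (d n : ℕ) : FA n :=
  (d : Kf)⁻¹ • ∑ m ∈ Finset.range d, Tt n 1 ^ m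

/-- The action of the simple transposition `s_i` on indices: swaps `i` and `i+1`. -/
def sAct (i j : ℕ) : ℕ := if j = i then i + 1 else if j = i + 1 then i else j

/-- The defining relations of the framization `Y_{d,n}^B` of the Hecke algebra of type B. -/
inductive YBrel (d n : ℕ) : FA n → FA n → Prop
  | gg : ∀ i j : ℕ, 1 ≤ i → i ≤ n - 1 → 1 ≤ j → j ≤ n - 1 → (i + 1 < j ∨ j + 1 < i) →
      YBrel d n (Gg n i * Gg n j) (Gg n j * Gg n i)
  | braid : ∀ i : ℕ, 1 ≤ i → i ≤ n - 2 →
      YBrel d n (Gg n i * Gg n (i + 1) * Gg n i) (Gg n (i + 1) * Gg n i * Gg n (i + 1))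
  | bg : ∀ i : ℕ, 2 ≤ i → i ≤ n - 1 → YBrel d n (Bb n * Gg n i) (Gg n i * Bb n)
  | bgbg : YBrel d n (Bb n * Gg n 1 * Bb n * Gg n 1) (Gg n 1 * Bb n * Gg n 1 * Bb n)
  | tt : ∀ i j : ℕ, 1 ≤ i → i ≤ n → 1 ≤ j → j ≤ n →
      YBrel d n (Tt n i * Tt n j) (Tt n j * Tt n i)
  | tg : ∀ i j : ℕ, 1 ≤ i → i ≤ n - 1 → 1 ≤ j → j ≤ n →
      YBrel d n (Tt n j * Gg n i) (Gg n i * Tt n (sAct i j))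
  | tb : ∀ i : ℕ, 1 ≤ i → i ≤ n → YBrel d n (Tt n i * Bb n) (Bb n * Tt n i)
  | td : ∀ i : ℕ, 1 ≤ i → i ≤ n → YBrel d n (Tt n i ^ d) 1
  | gsq : ∀ i : ℕ, 1 ≤ i → i ≤ n - 1 →
      YBrel d n (Gg n i ^ 2) (1 + (uu - uu⁻¹) • (eF d n i * Gg n i))
  | bsq : YBrel d n (Bb n ^ 2) (1 + (vv - vv⁻¹) • (fF d n * Bb n))

/-- The framization of the Hecke algebra of type B, `Y_{d,n}^B`. -/
abbrev YB (d n : ℕ) : Type := RingQuot (YBrel d n)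

instance (d n : ℕ) : Ring (YB d n) := RingQuot.instRing (YBrel d n)

instance (d n : ℕ) : Algebra Kf (YB d n) := RingQuot.instAlgebra _

instance (d n : ℕ) : Module Kf (YB d n) := Algebra.toModule

/-- The canonical projection from the free algebra onto `Y_{d,n}^B`. -/
def mkY (d n : ℕ) : FA n →ₐ[Kf] YB d n := RingQuot.mkAlgHom Kf (YBrel d n)

/-- The generator `b₁` of `Y_{d,n}^B`. -/
def bY (d n : ℕ) : YB d n := mkY d n (Bb n)

/-- The generator `g_i` of `Y_{d,n}^B`. -/
def gY (d n : ℕ) (i : ℕ) : YB d n := mkY d n (Gg n i)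

/-- The generator `t_j` of `Y_{d,n}^B`. -/
def tY (d n : ℕ) (j : ℕ) : YB d n := mkY d n (Tt n j)

/-- The idempotent `e_i` of `Y_{d,n}^B`. -/
def eY (d n : ℕ) (i : ℕ) : YB d n := mkY d n (eF d n i)

/-- The idempotent `f₁` of `Y_{d,n}^B`. -/
def fY (d n : ℕ) : YB d n := mkY d n (fF d n)

/-- The element `g_i⁻¹ = g_i - (u - u⁻¹) e_i`. -/
def gInv (d n i : ℕ) : YB d n := gY d n i - (uu - uu⁻¹) • eY d n i

/-- The elements `b_k := g_{k-1} ⋯ g_1 b_1 g_1⁻¹ ⋯ g_{k-1}⁻¹` for `2 ≤ k ≤ n`,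
defined by `b_k = g_{k-1} b_{k-1} g_{k-1}⁻¹`; with `b_1` the generator `b₁`. -/
def bk (d n : ℕ) : ℕ → YB d n
  | 0 => 1
  | 1 => bY d n
  | (k + 2) => gY d n (k + 1) * bk d n (k + 1) * gInv d n (k + 1)

/-- The descending product `g_{k-1} g_{k-2} ⋯ g_j`. -/
def gRange (d n j k : ℕ) : YB d n := (((List.range' j (k - j)).reverse).map (gY d n)).prod

/-- The elements `𝔪⁺_{k,j,m}`: `𝔪⁺_{k,k,m} = t_k^m` and
`𝔪⁺_{k,j,m} = g_{k-1} ⋯ g_j t_j^m` for `j < k`. -/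
def mPlus (d n k j m : ℕ) : YB d n :=
  if j = k then tY d n k ^ m else gRange d n j k * tY d n j ^ m

/-- The elements `𝔪⁻_{k,j,m}`: `𝔪⁻_{k,k,m} = t_k^m b_k` and
`𝔪⁻_{k,j,m} = g_{k-1} ⋯ g_j b_j t_j^m` for `j < k`. -/
def mMinus (d n k j m : ℕ) : YB d n :=
  if j = k then tY d n k ^ m * bk d n k else gRange d n j k * (bk d n j * tY d n j ^ m)

/-- The subsets `M_{d,k}` of `Y_{d,n}^B`:
`M_{d,1} = {t₁^m, t₁^m b₁}` and `M_{d,k} = {t_k^m, t_k^m b_k, g_{k-1} x : x ∈ M_{d,k-1}}`. -/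
def Mset (d n : ℕ) : ℕ → Set (YB d n)
  | 0 => {1}
  | 1 => {x | ∃ m ≤ d - 1, x = tY d n 1 ^ m ∨ x = tY d n 1 ^ m * bY d n}
  | (k + 2) => {x |
      (∃ m ≤ d - 1, x = tY d n (k + 2) ^ m ∨ x = tY d n (k + 2) ^ m * bk d n (k + 2)) ∨
      ∃ y ∈ Mset d n (k + 1), x = gY d n (k + 1) * y}

/-- The set `𝖢_n` of all products `𝔪_1 𝔪_2 ⋯ 𝔪_n` with `𝔪_i ∈ M_{d,i}`. -/
def Cset (d n : ℕ) : Set (YB d n) :=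
  {x | ∃ f : Fin n → YB d n, (∀ i : Fin n, f i ∈ Mset d n (i.val + 1)) ∧
    x = (List.ofFn f).prod}

/-- Characterization of the natural inclusion `Y_{d,n}^B ⊆ Y_{d,n+1}^B`:
the algebra map sending generators to the generators of the same name. -/
def IsIncl (d n : ℕ) (inc : YB d n →ₐ[Kf] YB d (n + 1)) : Prop :=
  inc (bY d n) = bY d (n + 1) ∧
  (∀ i, 1 ≤ i → i ≤ n - 1 → inc (gY d n i) = gY d (n + 1) i) ∧
  (∀ j, 1 ≤ j → j ≤ n → inc (tY d n j) = tY d (n + 1) j)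

/-- Characterization of the relative trace `tr_{n+1} : Y_{d,n+1}^B → Y_{d,n}^B`
(with respect to trace parameters `x`, `y`): it is the `L`-linear map defined on the
basis `𝖢_{n+1}` by `tr(w t_{n+1}^m) = x_m w`, `tr(w b_{n+1} t_{n+1}^m) = y_m w`, and
`tr(w 𝔪^±_{n+1,k,m}) = z (w 𝔪^±_{n,k,m})` for `k < n+1`, where `w ∈ 𝖢_n`. -/
def IsRelTrace (d : ℕ) (x y : ZMod d → Kf) (n : ℕ)
    (inc : YB d n →ₐ[Kf] YB d (n + 1)) (tr : YB d (n + 1) →ₗ[Kf] YB d n) : Prop :=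
  ∀ w ∈ Cset d n, ∀ m : ℕ, m ≤ d - 1 →
    (tr (inc w * tY d (n + 1) (n + 1) ^ m) = x (m : ZMod d) • w) ∧
    (tr (inc w * (bk d (n + 1) (n + 1) * tY d (n + 1) (n + 1) ^ m)) = y (m : ZMod d) • w) ∧
    (∀ k, 1 ≤ k → k ≤ n →
      tr (inc w * mPlus d (n + 1) (n + 1) k m) = zz • (w * mPlus d n n k m) ∧
      tr (inc w * mMinus d (n + 1) (n + 1) k m) = zz • (w * mMinus d n n k m))

/-- Characterization of the trace `tr_1 : Y_{d,1}^B → L`: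
`tr_1(t₁^a) = x_a` and `tr_1(b₁ t₁^a) = y_a`. -/
def IsTr1 (d : ℕ) (x y : ZMod d → Kf) (tr1 : YB d 1 →ₗ[Kf] Kf) : Prop :=
  ∀ a : ℕ, a ≤ d - 1 →
    tr1 (tY d 1 1 ^ a) = x (a : ZMod d) ∧ tr1 (bY d 1 * tY d 1 1 ^ a) = y (a : ZMod d)

/-- The Markov trace tower `Tr_{m+1} = tr_1 ∘ tr_2 ∘ ⋯ ∘ tr_{m+1} : Y_{d,m+1}^B → L`,
built from the relative traces (`tr k` here is the relative trace
`tr_{k+2} : Y_{d,k+2}^B → Y_{d,k+1}^B`). -/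
def TrT (d : ℕ) (tr1 : YB d 1 →ₗ[Kf] Kf)
    (tr : (k : ℕ) → (YB d (k + 2) →ₗ[Kf] YB d (k + 1))) :
    (m : ℕ) → (YB d (m + 1) →ₗ[Kf] Kf)
  | 0 => tr1
  | (m + 1) => (TrT d tr1 tr m).comp (tr m)

/-- The embedding of the complex numbers into `L = ℂ(u,v,z)`. -/
def CtoL : ℂ →+* Kf :=
  (algebraMap (MvPolynomial (Fin 3) ℂ) Kf).comp (MvPolynomial.C : ℂ →+* MvPolynomial (Fin 3) ℂ)

/-- Relations between the lines spanned by the generators. -/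
structure SpanRel {S : Type*} [IdemSemiring S] (b : S) (G T : ℕ → S) : Prop where
  G_zero : G 0 = 0
  one_le_T : ∀ i, 1 ≤ T i
  T_mul_T_le : ∀ i, T i * T i ≤ T i
  T_comm : ∀ i j, Commute (T i) (T j)
  G_mul_T : ∀ i, G i * T i = T (i + 1) * G i
  G_mul_T_succ : ∀ i, G i * T (i + 1) = T i * G i
  G_T_comm : ∀ i j, j ≠ i → j ≠ i + 1 → Commute (G i) (T j)
  b_T_comm : ∀ i, Commute b (T i)
  b_sq_le : b * b ≤ 1 + T 1 * b
  G_sq_le : ∀ i, G i * G i ≤ 1 + T i * T (i + 1) * G i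
  G_comm : ∀ i j, i + 1 < j → Commute (G i) (G j)
  braid : ∀ i, G i * G (i + 1) * G i = G (i + 1) * G i * G (i + 1)
  b_G_comm : ∀ i, i ≠ 1 → Commute b (G i)
  b_G_b_G : b * G 1 * b * G 1 = G 1 * b * G 1 * b

/-- The lines spanned by the elements `g_{k-1} ⋯ g_1 b_1 g_1 ⋯ g_{k-1}`. -/
def murphyLine {S : Type*} [IdemSemiring S] (b : S) (G : ℕ → S) : ℕ → S
  | 0 => 1
  | 1 => b
  | (k + 2) => G (k + 1) * murphyLine b G (k + 1) * G (k + 1)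

/-- The filtration of the algebra by the subalgebras on the first `k` strands, described through
the expected spanning sets. -/
def strandSpan {S : Type*} [IdemSemiring S] (b : S) (G T : ℕ → S) : ℕ → S
  | 0 => 1
  | (k + 1) => strandSpan b G T k * T (k + 1) * (1 + murphyLine b G (k + 1)) +
      strandSpan b G T k * G k * strandSpan b G T k

theorem le_strandSpan_succ_left {S : Type*} [IdemSemiring S] (b : S) (G T : ℕ → S)
    (k : ℕ) :
    strandSpan b G T k * T (k + 1) ≤ strandSpan b G T (k + 1) := by
  rw [strandSpan, mul_add, mul_one]
  simp only [add_eq_sup]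
  exact le_sup_of_le_left le_sup_left

theorem le_strandSpan_succ_mid {S : Type*} [IdemSemiring S] (b : S) (G T : ℕ → S)
    (k : ℕ) :
    strandSpan b G T k * T (k + 1) * murphyLine b G (k + 1) ≤ strandSpan b G T (k + 1) := by
  rw [strandSpan, mul_add, mul_one]
  simp only [add_eq_sup]
  exact le_sup_of_le_left le_sup_right

theorem le_strandSpan_succ_right {S : Type*} [IdemSemiring S] (b : S) (G T : ℕ → S)
    (k : ℕ) :
    strandSpan b G T k * G k * strandSpan b G T k ≤ strandSpan b G T (k + 1) := by
  rw [strandSpan, mul_add, mul_one]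
  simp only [add_eq_sup]
  exact le_sup_right

namespace SpanRel

variable {S : Type*} [IdemSemiring S] {b : S} {G T : ℕ → S}

theorem murphyLine_T_comm (h : SpanRel b G T) (k j : ℕ) :
    Commute (murphyLine b G k) (T j) := by
  induction k using Nat.twoStepInduction generalizing j with
  | zero => exact Commute.one_left _
  | one => exact h.b_T_comm j
  | more k _ ih =>
    simp only [murphyLine]
    by_cases h1 : j = k + 1
    · subst h1
      have := h.G_mul_T (k + 1)
      have h2 := h.G_mul_T_succ (k + 1)
      have h3 := (ih (k + 1 + 1)).eq
      simp only [Commute, SemiconjBy, mul_assoc]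
      rw [this, ← mul_assoc (murphyLine b G (k + 1)), h3, mul_assoc, ← mul_assoc, h2, mul_assoc]
    by_cases h1' : j = k + 1 + 1
    · subst h1'
      have := h.G_mul_T (k + 1)
      have h2 := h.G_mul_T_succ (k + 1)
      have h3 := (ih (k + 1)).eq
      simp only [Commute, SemiconjBy, mul_assoc]
      rw [h2, ← mul_assoc (murphyLine b G (k + 1)), h3, mul_assoc, ← mul_assoc, this, mul_assoc]
    · have := h.G_T_comm (k + 1) j h1 h1'
      exact (this.mul_left (ih j)).mul_left this

theorem murphyLine_G_comm (h : SpanRel b G T) {k j : ℕ} (hkj : k < j) :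
    Commute (murphyLine b G k) (G j) := by
  induction k using Nat.twoStepInduction with
  | zero => exact Commute.one_left _
  | one => exact h.b_G_comm j (by omega)
  | more k _ ih =>
    have := h.G_comm (k + 1) j (by omega)
    exact (this.mul_left (ih (by omega))).mul_left this

theorem strandSpan_T_comm (h : SpanRel b G T) {k j : ℕ} (hkj : k < j) :
    Commute (strandSpan b G T k) (T j) := by
  induction k with
  | zero => exact Commute.one_left _
  | succ k ih =>
    have i1 := ih (by omega)
    have i2 := h.G_T_comm k j (by omega) (by omega)
    exact ((i1.mul_left (h.T_comm _ _)).mul_left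
      ((Commute.one_left _).add_left (h.murphyLine_T_comm _ _))).add_left
      ((i1.mul_left i2).mul_left i1)

theorem strandSpan_G_comm (h : SpanRel b G T) {k j : ℕ} (hkj : k < j) :
    Commute (strandSpan b G T k) (G j) := by
  induction k with
  | zero => exact Commute.one_left _
  | succ k ih =>
    have i1 := ih (by omega)
    exact ((i1.mul_left (h.G_T_comm j (k + 1) (by omega) (by omega)).symm).mul_left
      ((Commute.one_left _).add_left (h.murphyLine_G_comm hkj))).add_left
      ((i1.mul_left (h.G_comm k j hkj)).mul_left i1)

theorem G_murphyLine_comm (h : SpanRel b G T) (j : ℕ) :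
    Commute (G j) (murphyLine b G (j + 2)) := by
  cases j with
  | zero => rw [h.G_zero]; exact Commute.zero_left _
  | succ i =>
    have h1 := (h.murphyLine_G_comm (show i + 1 < i + 2 by omega)).eq
    have h2 := h.braid (i + 1)
    simp only [murphyLine, Commute, SemiconjBy]
    calc G (i + 1) * (G (i + 1 + 1) * (G (i + 1) * murphyLine b G (i + 1) * G (i + 1)) *
          G (i + 1 + 1))
        = (G (i + 1) * G (i + 1 + 1) * G (i + 1)) * murphyLine b G (i + 1) * G (i + 1) *
          G (i + 1 + 1) := by simp only [mul_assoc]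
      _ = G (i + 1 + 1) * G (i + 1) * (G (i + 2) * murphyLine b G (i + 1)) * G (i + 1) *
          G (i + 1 + 1) := by rw [h2]; simp only [mul_assoc]
      _ = G (i + 1 + 1) * G (i + 1) * murphyLine b G (i + 1) * (G (i + 1 + 1) * G (i + 1) *
          G (i + 1 + 1)) := by rw [← h1]; simp only [mul_assoc]
      _ = _ := by rw [← h2]; simp only [mul_assoc]

theorem murphyLine_succ_comm (h : SpanRel b G T) (j : ℕ) :
    Commute (murphyLine b G (j + 1)) (murphyLine b G (j + 2)) := by
  induction j with
  | zero =>
    have := h.b_G_b_G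
    simp only [murphyLine, Commute, SemiconjBy]
    simp only [mul_assoc] at this ⊢
    exact this
  | succ i ih =>
    have h1 := h.G_murphyLine_comm (i + 1)
    have h2 := h.murphyLine_G_comm (show i + 1 < i + 2 by omega)
    have h3 : Commute (murphyLine b G (i + 1)) (murphyLine b G (i + 3)) :=
      (h2.mul_right ih).mul_right h2
    exact (h1.mul_left h3).mul_left h1

theorem strandSpan_murphyLine_comm (h : SpanRel b G T) {k j : ℕ} (hkj : k < j) :
    Commute (strandSpan b G T k) (murphyLine b G j) := by
  induction j using Nat.twoStepInduction generalizing k with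
  | zero => exact Commute.one_right _
  | one =>
    obtain rfl : k = 0 := by omega
    exact Commute.one_left _
  | more j _ ih =>
    have key : ∀ i ≤ j, Commute (strandSpan b G T i) (murphyLine b G (j + 2)) := fun i hi => by
      have h1 := h.strandSpan_G_comm (show i < j + 1 by omega)
      exact (h1.mul_right (ih (by omega))).mul_right h1
    rcases Nat.lt_or_ge k (j + 1) with hk | hk
    · exact key k (by omega)
    · obtain rfl : k = j + 1 := by omega
      have h1 := key j le_rfl
      exact ((h1.mul_left (h.murphyLine_T_comm _ _).symm).mul_left
        ((Commute.one_left _).add_left (h.murphyLine_succ_comm j))).add_left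
        ((h1.mul_left (h.G_murphyLine_comm j)).mul_left h1)

theorem strandSpan_le_succ (h : SpanRel b G T) (k : ℕ) :
    strandSpan b G T k ≤ strandSpan b G T (k + 1) :=
  (le_mul_of_one_le_right' (h.one_le_T _)).trans (le_strandSpan_succ_left b G T k)

theorem strandSpan_mono (h : SpanRel b G T) : Monotone (strandSpan b G T) :=
  monotone_nat_of_le_succ h.strandSpan_le_succ

theorem one_le_strandSpan (h : SpanRel b G T) (k : ℕ) : 1 ≤ strandSpan b G T k :=
  h.strandSpan_mono (Nat.zero_le k)

theorem T_le_strandSpan (h : SpanRel b G T) (k : ℕ) : T (k + 1) ≤ strandSpan b G T (k + 1) :=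
  (le_mul_of_one_le_left' (h.one_le_strandSpan k)).trans (le_strandSpan_succ_left b G T k)

theorem G_le_strandSpan (h : SpanRel b G T) (k : ℕ) : G k ≤ strandSpan b G T (k + 1) :=
  calc G k ≤ strandSpan b G T k * G k * strandSpan b G T k :=
        (le_mul_of_one_le_left' (h.one_le_strandSpan k)).trans
          (le_mul_of_one_le_right' (h.one_le_strandSpan k))
    _ ≤ _ := le_strandSpan_succ_right b G T k

theorem murphyLine_le_strandSpan (h : SpanRel b G T) (k : ℕ) :
    murphyLine b G (k + 1) ≤ strandSpan b G T (k + 1) :=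
  (le_mul_of_one_le_left' ((h.one_le_strandSpan k).trans
    (le_mul_of_one_le_right' (h.one_le_T _)))).trans (le_strandSpan_succ_mid b G T k)

theorem G_mul_strandSpan_mul_G_le (h : SpanRel b G T) (k : ℕ) :
    G (k + 1) * (strandSpan b G T k * G k * strandSpan b G T k) * G (k + 1) ≤
      strandSpan b G T (k + 1) * G (k + 1) * strandSpan b G T (k + 1) := by
  set a := strandSpan b G T k with ha
  have hc : a * G (k + 1) = G (k + 1) * a := (h.strandSpan_G_comm (Nat.lt_succ_self k)).eq
  have h1 : a * G k ≤ strandSpan b G T (k + 1) :=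
    (le_mul_of_one_le_right' (h.one_le_strandSpan k)).trans (le_strandSpan_succ_right b G T k)
  have h2 : G k * a ≤ strandSpan b G T (k + 1) :=
    (le_mul_of_one_le_left' (h.one_le_strandSpan k)).trans
      ((mul_assoc _ _ _).symm.le.trans (le_strandSpan_succ_right b G T k))
  calc G (k + 1) * (a * G k * a) * G (k + 1)
      = (G (k + 1) * a) * G k * (a * G (k + 1)) := by simp only [mul_assoc]
    _ = a * (G (k + 1) * G k * G (k + 1)) * a := by rw [← hc, hc, ← hc]; nth_rw 2 [hc]; simp only [mul_assoc]
    _ = (a * G k) * G (k + 1) * (G k * a) := by rw [← h.braid]; simp only [mul_assoc]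
    _ ≤ _ := mul_le_mul' (mul_le_mul' h1 le_rfl) h2

/-- Each `strandSpan` is closed under multiplication. -/
theorem strandSpan_mul_self_le (h : SpanRel b G T) (k : ℕ) :
    strandSpan b G T k * strandSpan b G T k ≤ strandSpan b G T k := by
  induction k with
  | zero => simp [strandSpan]
  | succ k ih =>
    have aT : strandSpan b G T k * T (k + 1) = T (k + 1) * strandSpan b G T k :=
      (h.strandSpan_T_comm (Nat.lt_succ_self k)).eq
    have aB : strandSpan b G T k * murphyLine b G (k + 1) =
        murphyLine b G (k + 1) * strandSpan b G T k :=
      (h.strandSpan_murphyLine_comm (Nat.lt_succ_self k)).eq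
    have TB : murphyLine b G (k + 1) * T (k + 1) = T (k + 1) * murphyLine b G (k + 1) :=
      (h.murphyLine_T_comm _ _).eq
    have TT := h.T_mul_T_le (k + 1)
    have GT := h.G_mul_T_succ k
    have v1 := le_strandSpan_succ_left b G T k
    have v2 := le_strandSpan_succ_mid b G T k
    have v3 := le_strandSpan_succ_right b G T k
    have aV := h.strandSpan_le_succ k
    have BV := h.murphyLine_le_strandSpan k
    have hV : strandSpan b G T (k + 1) = strandSpan b G T k * T (k + 1) +
        strandSpan b G T k * T (k + 1) * murphyLine b G (k + 1) +
        strandSpan b G T k * G k * strandSpan b G T k := by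
      rw [strandSpan, mul_add, mul_one]
    set a := strandSpan b G T k with ha
    set t := T (k + 1) with ht
    set B := murphyLine b G (k + 1) with hB
    set V := strandSpan b G T (k + 1) with hVdef
    have Va : V * a ≤ V := by
      nth_rw 1 [hV]
      rw [add_mul, add_mul]
      refine add_le (add_le ?_ ?_) ?_
      · calc a * t * a = a * a * t := by rw [mul_assoc, ← aT, mul_assoc]
          _ ≤ a * t := mul_le_mul' ih le_rfl
          _ ≤ V := v1
      · calc a * t * B * a = a * a * t * B := by
              rw [mul_assoc, ← aB, ← mul_assoc, mul_assoc a t a, ← aT, mul_assoc a a t]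
          _ ≤ a * t * B := mul_le_mul' (mul_le_mul' ih le_rfl) le_rfl
          _ ≤ V := v2
      · calc a * G k * a * a = a * G k * (a * a) := by rw [mul_assoc]
          _ ≤ a * G k * a := mul_le_mul' le_rfl ih
          _ ≤ V := v3
    have atB : a * t * B * t ≤ a * t * B := by
      calc a * t * B * t = a * (t * t) * B := by rw [mul_assoc, TB]; simp only [mul_assoc]
        _ ≤ a * t * B := mul_le_mul' (mul_le_mul' le_rfl TT) le_rfl
    have Vt : V * t ≤ V := by
      nth_rw 1 [hV]
      rw [add_mul, add_mul]
      refine add_le (add_le ?_ (atB.trans v2)) ?_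
      · calc a * t * t = a * (t * t) := by rw [mul_assoc]
          _ ≤ a * t := mul_le_mul' le_rfl TT
          _ ≤ V := v1
      · cases k with
        | zero => rw [h.G_zero]; simp
        | succ i =>
          have Ta : T (i + 1) ≤ a := h.T_le_strandSpan i
          calc a * G (i + 1) * a * t = a * (G (i + 1) * t) * a := by
                rw [mul_assoc, aT]; simp only [mul_assoc]
            _ = a * T (i + 1) * G (i + 1) * a := by rw [GT]; simp only [mul_assoc]
            _ ≤ a * a * G (i + 1) * a :=
                mul_le_mul' (mul_le_mul' (mul_le_mul' le_rfl Ta) le_rfl) le_rfl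
            _ ≤ a * G (i + 1) * a := mul_le_mul' (mul_le_mul' ih le_rfl) le_rfl
            _ ≤ V := v3
    suffices hs : V * G k ≤ V ∧ V * B ≤ V by
      nth_rw 2 [hV]
      simp only [mul_add, ← mul_assoc]
      refine add_le (add_le ?_ ?_) ?_
      · exact (mul_le_mul' Va le_rfl).trans Vt
      · exact (mul_le_mul' ((mul_le_mul' Va le_rfl).trans Vt) le_rfl).trans hs.2
      · exact (mul_le_mul' ((mul_le_mul' Va le_rfl).trans hs.1) le_rfl).trans Va
    cases k with
    | zero =>
      refine ⟨by rw [h.G_zero]; simp, ?_⟩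
      have ha1 : a = 1 := rfl
      have hBb : B = b := rfl
      have v2' : t * B ≤ V := by simpa [ha1] using v2
      nth_rw 1 [hV]
      rw [h.G_zero, ha1]
      simp only [one_mul, zero_mul, add_zero, add_mul]
      refine add_le v2' ?_
      calc t * B * B = t * (B * B) := mul_assoc _ _ _
        _ ≤ t * (1 + t * B) := mul_le_mul' le_rfl h.b_sq_le
        _ = t + t * t * B := by rw [mul_add, mul_one, mul_assoc]
        _ ≤ t + t * B := add_le_add le_rfl (mul_le_mul' TT le_rfl)
        _ ≤ V := add_le (by simpa [ha1] using v1) v2'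
    | succ i =>
      set g := G (i + 1) with hg
      set s := T (i + 1) with hs
      set β := murphyLine b G (i + 1) with hβ
      have sa : s ≤ a := h.T_le_strandSpan i
      have βa : β ≤ a := h.murphyLine_le_strandSpan i
      have one_a : 1 ≤ a := h.one_le_strandSpan _
      have aa : ∀ {p q : S}, p ≤ a → q ≤ a → p * q ≤ a := fun hp hq =>
        (mul_le_mul' hp hq).trans ih
      have hBg : B = g * β * g := rfl
      have gs : g * s = t * g := h.G_mul_T _
      have gg : g * g ≤ 1 + s * t * g := h.G_sq_le _
      have Q : ∀ {p q : S}, p ≤ a → q ≤ a → p * g * q ≤ V := fun hp hq =>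
        (mul_le_mul' (mul_le_mul' hp le_rfl) hq).trans v3
      have aTQ : ∀ {p : S}, p ≤ a → a * t * g * p ≤ V := fun {p} hp => by
        calc a * t * g * p = (a * t) * (g * p) := mul_assoc _ _ _
          _ = a * (t * g) * p := by simp only [mul_assoc]
          _ = a * g * (s * p) := by rw [← gs]; simp only [mul_assoc]
          _ ≤ V := Q le_rfl (aa sa hp)
      have Vg : V * g ≤ V := by
        nth_rw 1 [hV]
        rw [add_mul, add_mul]
        have st : s * t = t * s := (h.T_comm _ _).eq
        have e1 : a * s ≤ a := aa le_rfl sa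
        refine add_le (add_le (by simpa using aTQ one_a) ?_) ?_
        · have e2 : a * t * g * β * (s * t * g) ≤ a * t * B := by
            have βs : β * s = s * β := (h.murphyLine_T_comm _ _).eq
            have βt : β * t = t * β := (h.murphyLine_T_comm _ _).eq
            calc a * t * g * β * (s * t * g)
                = a * t * g * (β * s) * t * g := by simp only [mul_assoc]
              _ = a * t * (g * s) * (β * t) * g := by rw [βs]; simp only [mul_assoc]
              _ = a * t * t * (g * t) * β * g := by rw [gs, βt]; simp only [mul_assoc]
              _ = a * (t * t) * s * (g * β * g) := by rw [GT]; simp only [mul_assoc]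
              _ ≤ a * t * s * (g * β * g) :=
                  mul_le_mul' (mul_le_mul' (mul_le_mul' le_rfl TT) le_rfl) le_rfl
              _ = a * s * t * B := by rw [hBg, mul_assoc a t s, ← st, ← mul_assoc a s t]
              _ ≤ a * t * B := mul_le_mul' (mul_le_mul' e1 le_rfl) le_rfl
          calc a * t * B * g = a * t * g * β * (g * g) := by rw [hBg]; simp only [mul_assoc]
            _ ≤ a * t * g * β * (1 + s * t * g) := mul_le_mul' le_rfl gg
            _ = a * t * g * β + a * t * g * β * (s * t * g) := by rw [mul_add, mul_one]
            _ ≤ V := add_le (aTQ βa) (e2.trans v2)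
        · have ca : strandSpan b G T i * g = g * strandSpan b G T i :=
            (h.strandSpan_G_comm (Nat.lt_succ_self i)).eq
          have ca' : strandSpan b G T i ≤ a := h.strandSpan_le_succ i
          have hA : a = strandSpan b G T i * s + strandSpan b G T i * s * β +
              strandSpan b G T i * G i * strandSpan b G T i := by
            rw [ha, strandSpan, mul_add, mul_one]
          have hsand := h.G_mul_strandSpan_mul_G_le i
          set c := strandSpan b G T i with hc
          have f1 : g * (c * s) * g ≤ V := by
            calc g * (c * s) * g = (c * g) * s * g := by rw [ca]; simp only [mul_assoc]
              _ = c * t * (g * g) := by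
                  rw [mul_assoc c g s, gs]; simp only [mul_assoc]
              _ ≤ a * t * (1 + s * t * g) := mul_le_mul' (mul_le_mul' ca' le_rfl) gg
              _ = a * t + a * (t * s) * t * g := by
                  rw [mul_add, mul_one]; simp only [mul_assoc]
              _ = a * t + a * s * (t * t) * g := by rw [← st]; simp only [mul_assoc]
              _ ≤ a * t + a * t * g :=
                  add_le_add le_rfl (mul_le_mul' (mul_le_mul' e1 TT) le_rfl)
              _ ≤ V := add_le v1 (by simpa using aTQ one_a)
          have f2 : g * (c * s * β) * g ≤ V := by
            calc g * (c * s * β) * g = (c * g) * s * β * g := by rw [ca]; simp only [mul_assoc]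
              _ = c * t * B := by rw [mul_assoc c g s, gs, hBg]; simp only [mul_assoc]
              _ ≤ a * t * B := mul_le_mul' (mul_le_mul' ca' le_rfl) le_rfl
              _ ≤ V := v2
          have f3 : g * a * g ≤ V := by
            rw [hA, mul_add, mul_add, add_mul, add_mul]
            exact add_le (add_le f1 f2) (hsand.trans v3)
          have aVV : a * V ≤ V := by
            nth_rw 1 [hV]
            simp only [mul_add, ← mul_assoc]
            exact add_le (add_le ((mul_le_mul' ih le_rfl).trans v1)
              ((mul_le_mul' (mul_le_mul' ih le_rfl) le_rfl).trans v2))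
              ((mul_le_mul' (mul_le_mul' ih le_rfl) le_rfl).trans v3)
          calc a * g * a * g = a * (g * a * g) := by simp only [mul_assoc]
            _ ≤ a * V := mul_le_mul' le_rfl f3
            _ ≤ V := aVV
      refine ⟨Vg, ?_⟩
      calc V * B = V * g * β * g := by rw [hBg]; simp only [mul_assoc]
        _ ≤ V * β * g := mul_le_mul' (mul_le_mul' Vg le_rfl) le_rfl
        _ ≤ V * a * g := mul_le_mul' (mul_le_mul' le_rfl βa) le_rfl
        _ ≤ V * g := mul_le_mul' Va le_rfl
        _ ≤ V := Vg

/-- If the lines `β k` are spanned by the conjugates `g_{k-1} ⋯ g_1 b_1 g_1⁻¹ ⋯ g_{k-1}⁻¹`,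
they agree with the lines `murphyLine b G k` up to lower terms. -/
theorem murphyLine_congr (h : SpanRel b G T) {β : ℕ → S} {n : ℕ} (h1 : β 1 = b)
    (hβ : ∀ k, 1 ≤ k → k < n →
      β (k + 1) ≤ G k * β k * G k + G k * β k * (T k * T (k + 1)) ∧
      G k * β k * G k ≤ β (k + 1) + G k * β k * (T k * T (k + 1))) (k : ℕ) (hk : k < n) :
    β (k + 1) ≤ murphyLine b G (k + 1) + strandSpan b G T k * G k * strandSpan b G T k ∧
    murphyLine b G (k + 1) ≤ β (k + 1) + strandSpan b G T k * G k * strandSpan b G T k := by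
  induction k with
  | zero =>
    have : murphyLine b G (0 + 1) = β (0 + 1) := h1.symm
    rw [this]
    simp
  | succ k ih =>
    obtain ⟨i1, i2⟩ := ih (by omega)
    obtain ⟨j1, j2⟩ := hβ (k + 1) (by omega) hk
    have hsand := h.G_mul_strandSpan_mul_G_le k
    have hQ := le_strandSpan_succ_right b G T k
    have βa : β (k + 1) ≤ strandSpan b G T (k + 1) :=
      i1.trans (add_le (h.murphyLine_le_strandSpan k) hQ)
    have hm : murphyLine b G (k + 1 + 1) = G (k + 1) * murphyLine b G (k + 1) * G (k + 1) := rfl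
    have aT := (h.strandSpan_T_comm (Nat.lt_succ_self (k + 1))).eq
    have GT := h.G_mul_T_succ (k + 1)
    have Ta := h.T_le_strandSpan k
    have hlow : G (k + 1) * β (k + 1) * (T (k + 1) * T (k + 1 + 1)) ≤
        strandSpan b G T (k + 1) * G (k + 1) * strandSpan b G T (k + 1) := by
      have haa := h.strandSpan_mul_self_le (k + 1)
      set a := strandSpan b G T (k + 1)
      calc G (k + 1) * β (k + 1) * (T (k + 1) * T (k + 1 + 1))
          ≤ G (k + 1) * a * (a * T (k + 1 + 1)) :=
            mul_le_mul' (mul_le_mul' le_rfl βa) (mul_le_mul' Ta le_rfl)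
        _ = G (k + 1) * (a * a) * T (k + 1 + 1) := by simp only [mul_assoc]
        _ ≤ G (k + 1) * a * T (k + 1 + 1) := mul_le_mul' (mul_le_mul' le_rfl haa) le_rfl
        _ = G (k + 1) * T (k + 1 + 1) * a := by rw [mul_assoc, aT, mul_assoc]
        _ = T (k + 1) * G (k + 1) * a := by rw [GT]
        _ ≤ a * G (k + 1) * a := mul_le_mul' (mul_le_mul' Ta le_rfl) le_rfl
    constructor
    · refine j1.trans (add_le ?_ (hlow.trans le_add_self))
      rw [hm]
      refine (mul_le_mul' (mul_le_mul' le_rfl i1) le_rfl).trans ?_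
      rw [mul_add, add_mul]
      exact add_le_add le_rfl hsand
    · rw [hm]
      refine (mul_le_mul' (mul_le_mul' le_rfl i2) le_rfl).trans ?_
      rw [mul_add, add_mul]
      exact add_le (j2.trans (add_le_add le_rfl hlow)) (hsand.trans le_add_self)

/-- The recursion for the spanning sets, in terms of lines `β k` as in `murphyLine_congr`. -/
theorem strandSpan_succ_le (h : SpanRel b G T) {β X : ℕ → S} {n : ℕ} (h1 : β 1 = b)
    (hβ : ∀ k, 1 ≤ k → k < n →
      β (k + 1) ≤ G k * β k * G k + G k * β k * (T k * T (k + 1)) ∧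
      G k * β k * G k ≤ β (k + 1) + G k * β k * (T k * T (k + 1)))
    (hT : ∀ k, k < n → T (k + 1) ≤ X (k + 1))
    (hTβ : ∀ k, k < n → T (k + 1) * β (k + 1) ≤ X (k + 1))
    (hG : ∀ k, 1 ≤ k → k < n → G k * X k ≤ X (k + 1)) (k : ℕ) (hk : k < n) :
    strandSpan b G T (k + 1) ≤ strandSpan b G T k * X (k + 1) := by
  induction k with
  | zero =>
    have e : strandSpan b G T (0 + 1) =
        1 * T (0 + 1) * (1 + murphyLine b G (0 + 1)) + 1 * G 0 * 1 := rfl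
    rw [e, h.G_zero]
    simp only [strandSpan, one_mul, mul_zero, add_zero, mul_add, mul_one]
    have : murphyLine b G (0 + 1) = β (0 + 1) := h1.symm
    rw [this]
    exact add_le (hT 0 hk) (hTβ 0 hk)
  | succ k ih =>
    have ih := ih (by omega)
    have i2 := (h.murphyLine_congr h1 hβ (k + 1) hk).2
    have haa := h.strandSpan_mul_self_le (k + 1)
    have aT := (h.strandSpan_T_comm (Nat.lt_succ_self (k + 1))).eq
    have cG := (h.strandSpan_G_comm (Nat.lt_succ_self k)).eq
    have ca := h.strandSpan_le_succ k
    have GT := h.G_mul_T (k + 1)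
    have Ta := h.T_le_strandSpan k
    have hT := hT (k + 1) hk
    have hTβ := hTβ (k + 1) hk
    have hG := hG (k + 1) (by omega) hk
    rw [strandSpan]
    set a := strandSpan b G T (k + 1)
    set c := strandSpan b G T k
    have hQ : a * G (k + 1) * a ≤ a * X (k + 1 + 1) := by
      calc a * G (k + 1) * a ≤ a * G (k + 1) * (c * X (k + 1)) := mul_le_mul' le_rfl ih
        _ = a * (G (k + 1) * c) * X (k + 1) := by simp only [mul_assoc]
        _ = a * c * (G (k + 1) * X (k + 1)) := by rw [← cG]; simp only [mul_assoc]
        _ ≤ a * X (k + 1 + 1) := mul_le_mul' ((mul_le_mul' le_rfl ca).trans haa) hG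
    refine add_le ?_ hQ
    rw [mul_add, mul_one]
    refine add_le (mul_le_mul' le_rfl hT) ?_
    refine (mul_le_mul' le_rfl i2).trans ?_
    rw [mul_add]
    refine add_le ?_ (le_trans ?_ hQ)
    · rw [mul_assoc]; exact mul_le_mul' le_rfl hTβ
    · calc a * T (k + 1 + 1) * (a * G (k + 1) * a)
          = a * (T (k + 1 + 1) * a) * G (k + 1) * a := by simp only [mul_assoc]
        _ = a * a * (T (k + 1 + 1) * G (k + 1)) * a := by rw [← aT]; simp only [mul_assoc]
        _ = (a * a) * G (k + 1) * (T (k + 1) * a) := by rw [← GT]; simp only [mul_assoc]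
        _ ≤ a * G (k + 1) * a :=
          mul_le_mul' (mul_le_mul' haa le_rfl) ((mul_le_mul' Ta le_rfl).trans haa)

/-- A multiplicatively closed element above the generators on `n` strands is above
`strandSpan b G T n`. -/
theorem strandSpan_le (h : SpanRel b G T) {s : S} {n : ℕ} (h1 : 1 ≤ s) (hs : s * s ≤ s)
    (hb : b ≤ s) (hT : ∀ k, k < n → T (k + 1) ≤ s) (hG : ∀ k, 1 ≤ k → k < n → G k ≤ s)
    (k : ℕ) (hk : k ≤ n) : strandSpan b G T k ≤ s := by
  have hm : ∀ {p q : S}, p ≤ s → q ≤ s → p * q ≤ s := fun hp hq => (mul_le_mul' hp hq).trans hs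
  have hG' : ∀ k < n, G k ≤ s := fun k hk => by
    cases k with
    | zero => rw [h.G_zero]; exact zero_le
    | succ k => exact hG _ (by omega) hk
  have hB : ∀ k ≤ n, murphyLine b G k ≤ s := fun k => by
    induction k using Nat.twoStepInduction with
    | zero => exact fun _ => h1
    | one => exact fun _ => hb
    | more k _ ih => exact fun hk => hm (hm (hG' _ (by omega)) (ih (by omega))) (hG' _ (by omega))
  induction k with
  | zero => exact h1
  | succ k ih =>
    have ih := ih (by omega)
    exact add_le (hm (hm ih (hT _ hk)) (add_le h1 (hB _ hk))) (hm (hm ih (hG' _ hk)) ih)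

end SpanRel

section SpanPow

variable {K R : Type*} [CommSemiring K] [Semiring R] [Algebra K R]

/-- The span of the powers of an element. -/
def spanPow (K : Type*) {R : Type*} [CommSemiring K] [Semiring R] [Algebra K R] (t : R) :
    Submodule K R :=
  Submodule.span K (Set.range fun m : ℕ => t ^ m)

theorem pow_mem_spanPow (t : R) (m : ℕ) : t ^ m ∈ spanPow K t :=
  Submodule.subset_span ⟨m, rfl⟩

theorem one_le_spanPow (t : R) : 1 ≤ spanPow K t := by
  rw [Submodule.one_le]
  simpa using pow_mem_spanPow (K := K) t 0

theorem spanPow_mul_self_le (t : R) : spanPow K t * spanPow K t ≤ spanPow K t := by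
  rw [spanPow, Submodule.span_mul_span, Submodule.span_le]
  rintro _ ⟨_, ⟨m, rfl⟩, _, ⟨k, rfl⟩, rfl⟩
  exact Submodule.subset_span ⟨m + k, pow_add t m k⟩

theorem spanPow_commute {s t : R} (h : Commute s t) : Commute (spanPow K s) (spanPow K t) := by
  rw [Commute, SemiconjBy, spanPow, spanPow, Submodule.span_mul_span, Submodule.span_mul_span]
  congr 1
  ext a
  constructor
  · rintro ⟨_, ⟨m, rfl⟩, _, ⟨k, rfl⟩, rfl⟩
    exact ⟨_, ⟨k, rfl⟩, _, ⟨m, rfl⟩, (h.pow_pow m k).symm.eq⟩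
  · rintro ⟨_, ⟨m, rfl⟩, _, ⟨k, rfl⟩, rfl⟩
    exact ⟨_, ⟨k, rfl⟩, _, ⟨m, rfl⟩, (h.pow_pow k m).eq⟩

theorem span_singleton_mul_spanPow {a s t : R} (h : SemiconjBy a s t) :
    Submodule.span K {a} * spanPow K s = spanPow K t * Submodule.span K {a} := by
  rw [spanPow, spanPow, Submodule.span_mul_span, Submodule.span_mul_span]
  congr 1
  ext x
  constructor
  · rintro ⟨_, rfl, _, ⟨k, rfl⟩, rfl⟩
    exact ⟨_, ⟨k, rfl⟩, _, rfl, (h.pow_right k).eq.symm⟩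
  · rintro ⟨_, ⟨k, rfl⟩, _, rfl, rfl⟩
    exact ⟨_, rfl, _, ⟨k, rfl⟩, (h.pow_right k).eq⟩

theorem span_singleton_mul_span_singleton (a b : R) :
    Submodule.span K {a} * Submodule.span K {b} = Submodule.span K {a * b} := by
  rw [Submodule.span_mul_span, Set.singleton_mul_singleton]

theorem span_singleton_commute {a b : R} (h : Commute a b) :
    Commute (Submodule.span K {a}) (Submodule.span K {b}) := by
  rw [Commute, SemiconjBy, span_singleton_mul_span_singleton, span_singleton_mul_span_singleton,
    h.eq]

end SpanPow

section Relations

variable {d n : ℕ}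

theorem mkY_rel {a b : FA n} (h : YBrel d n a b) : mkY d n a = mkY d n b :=
  RingQuot.mkAlgHom_rel Kf h

theorem tY_of_not {j : ℕ} (hj : ¬(1 ≤ j ∧ j ≤ n)) : tY d n j = 1 := by
  rw [tY, Tt, dif_neg hj, map_one]

theorem eY_eq (i : ℕ) :
    eY d n i = (d : Kf)⁻¹ • ∑ m ∈ Finset.range d, tY d n i ^ m * tY d n (i + 1) ^ (d - m) := by
  simp only [eY, eF, map_smul, map_sum, map_mul, map_pow, tY]

theorem fY_eq : fY d n = (d : Kf)⁻¹ • ∑ m ∈ Finset.range d, tY d n 1 ^ m := by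
  simp only [fY, fF, map_smul, map_sum, map_pow, tY]

theorem tY_comm (i j : ℕ) : Commute (tY d n i) (tY d n j) := by
  by_cases hi : 1 ≤ i ∧ i ≤ n
  · by_cases hj : 1 ≤ j ∧ j ≤ n
    · have := mkY_rel (YBrel.tt (d := d) i j hi.1 hi.2 hj.1 hj.2)
      simp only [map_mul] at this
      exact this
    · rw [tY_of_not hj]; exact Commute.one_right _
  · rw [tY_of_not hi]; exact Commute.one_left _

theorem bY_tY_comm (j : ℕ) : Commute (bY d n) (tY d n j) := by
  by_cases hj : 1 ≤ j ∧ j ≤ n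
  · have := mkY_rel (YBrel.tb (d := d) j hj.1 hj.2)
    simp only [map_mul] at this
    exact this.symm
  · rw [tY_of_not hj]; exact Commute.one_right _

theorem tY_mul_gY {i j : ℕ} (hi : 1 ≤ i) (hin : i < n) (hj : 1 ≤ j) (hjn : j ≤ n) :
    tY d n j * gY d n i = gY d n i * tY d n (sAct i j) := by
  have := mkY_rel (YBrel.tg (d := d) i j hi (by omega) hj hjn)
  simp only [map_mul] at this
  exact this

theorem gY_semiconj {i : ℕ} (hi : 1 ≤ i) (hin : i < n) :
    SemiconjBy (gY d n i) (tY d n i) (tY d n (i + 1)) := by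
  have := tY_mul_gY (d := d) hi hin (show 1 ≤ i + 1 by omega) hin
  simp only [sAct, show i + 1 ≠ i by omega, if_true, if_false] at this
  exact this.symm

theorem gY_semiconj_succ {i : ℕ} (hi : 1 ≤ i) (hin : i < n) :
    SemiconjBy (gY d n i) (tY d n (i + 1)) (tY d n i) := by
  have := tY_mul_gY (d := d) hi hin hi hin.le
  simp only [sAct, if_true] at this
  exact this.symm

theorem gY_tY_comm {i j : ℕ} (hi : 1 ≤ i) (hin : i < n) (h1 : j ≠ i) (h2 : j ≠ i + 1) :
    Commute (gY d n i) (tY d n j) := by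
  by_cases hj : 1 ≤ j ∧ j ≤ n
  · have := tY_mul_gY (d := d) hi hin hj.1 hj.2
    simp only [sAct, h1, h2, if_false] at this
    exact this.symm
  · rw [tY_of_not hj]; exact Commute.one_right _

theorem tY_pow_d {i : ℕ} (hi : 1 ≤ i) (hin : i ≤ n) : tY d n i ^ d = 1 := by
  have := mkY_rel (YBrel.td (d := d) i hi hin)
  simp only [map_pow, map_one] at this
  exact this

theorem tY_pow_mod {i : ℕ} (hi : 1 ≤ i) (hin : i ≤ n) (m : ℕ) :
    tY d n i ^ m = tY d n i ^ (m % d) := by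
  conv_lhs => rw [← Nat.div_add_mod m d]
  rw [pow_add, pow_mul, tY_pow_d hi hin, one_pow, one_mul]

end Relations

section Spanning

variable (d n : ℕ)

/-- The line spanned by `g_i`, or `0` when `i` is out of range. -/
def gLine (i : ℕ) : Submodule Kf (YB d n) :=
  if 1 ≤ i ∧ i < n then Submodule.span Kf {gY d n i} else 0

variable {d n}

theorem gLine_of {i : ℕ} (hi : 1 ≤ i) (hin : i < n) :
    gLine d n i = Submodule.span Kf {gY d n i} := if_pos ⟨hi, hin⟩

theorem gLine_of_not {i : ℕ} (hi : ¬(1 ≤ i ∧ i < n)) : gLine d n i = 0 := if_neg hi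

theorem eY_mem (i : ℕ) :
    eY d n i ∈ spanPow Kf (tY d n i) * spanPow Kf (tY d n (i + 1)) := by
  rw [eY_eq]
  exact Submodule.smul_mem _ _ (Submodule.sum_mem _ fun m _ =>
    Submodule.mul_mem_mul (pow_mem_spanPow _ _) (pow_mem_spanPow _ _))

theorem spanRel_YB (d n : ℕ) :
    SpanRel (Submodule.span Kf {bY d n}) (gLine d n) (fun i => spanPow Kf (tY d n i)) where
  G_zero := gLine_of_not (by omega)
  one_le_T i := one_le_spanPow _
  T_mul_T_le i := spanPow_mul_self_le _
  T_comm i j := spanPow_commute (tY_comm i j)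
  G_mul_T i := by
    by_cases hi : 1 ≤ i ∧ i < n
    · rw [gLine_of hi.1 hi.2]; exact span_singleton_mul_spanPow (gY_semiconj hi.1 hi.2)
    · rw [gLine_of_not hi, zero_mul, mul_zero]
  G_mul_T_succ i := by
    by_cases hi : 1 ≤ i ∧ i < n
    · rw [gLine_of hi.1 hi.2]; exact span_singleton_mul_spanPow (gY_semiconj_succ hi.1 hi.2)
    · rw [gLine_of_not hi, zero_mul, mul_zero]
  G_T_comm i j h1 h2 := by
    by_cases hi : 1 ≤ i ∧ i < n
    · rw [gLine_of hi.1 hi.2]; exact span_singleton_mul_spanPow (gY_tY_comm hi.1 hi.2 h1 h2)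
    · rw [gLine_of_not hi]; exact Commute.zero_left _
  b_T_comm i := span_singleton_mul_spanPow (bY_tY_comm i)
  b_sq_le := by
    rw [span_singleton_mul_span_singleton, Submodule.span_singleton_le_iff_mem]
    have h : bY d n * bY d n = 1 + (vv - vv⁻¹) • (fY d n * bY d n) := by
      have := mkY_rel (YBrel.bsq (d := d) (n := n))
      simp only [map_mul, map_add, map_one, map_smul, pow_two] at this
      exact this
    rw [h, Submodule.add_eq_sup]
    refine Submodule.add_mem_sup (Submodule.one_le.1 le_rfl) (Submodule.smul_mem _ _
      (Submodule.mul_mem_mul ?_ (Submodule.mem_span_singleton_self _)))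
    rw [fY_eq]
    exact Submodule.smul_mem _ _ (Submodule.sum_mem _ fun m _ => pow_mem_spanPow _ _)
  G_sq_le i := by
    by_cases hi : 1 ≤ i ∧ i < n
    · rw [gLine_of hi.1 hi.2, span_singleton_mul_span_singleton,
        Submodule.span_singleton_le_iff_mem]
      have h : gY d n i * gY d n i = 1 + (uu - uu⁻¹) • (eY d n i * gY d n i) := by
        have := mkY_rel (YBrel.gsq (d := d) (n := n) i hi.1 (by omega))
        simp only [map_mul, map_add, map_one, map_smul, pow_two] at this
        exact this
      rw [h, Submodule.add_eq_sup]
      exact Submodule.add_mem_sup (Submodule.one_le.1 le_rfl) (Submodule.smul_mem _ _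
        (Submodule.mul_mem_mul (eY_mem i) (Submodule.mem_span_singleton_self _)))
    · rw [gLine_of_not hi, zero_mul]; exact zero_le
  G_comm i j hij := by
    by_cases hi : 1 ≤ i ∧ i < n
    · by_cases hj : 1 ≤ j ∧ j < n
      · rw [gLine_of hi.1 hi.2, gLine_of hj.1 hj.2]
        refine span_singleton_commute ?_
        have := mkY_rel (YBrel.gg (d := d) (n := n) i j hi.1 (by omega) hj.1 (by omega)
          (Or.inl hij))
        simp only [map_mul] at this
        exact this
      · rw [gLine_of_not hj]; exact Commute.zero_right _
    · rw [gLine_of_not hi]; exact Commute.zero_left _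
  braid i := by
    by_cases hi : 1 ≤ i ∧ i < n
    · by_cases hj : 1 ≤ i + 1 ∧ i + 1 < n
      · rw [gLine_of hi.1 hi.2, gLine_of hj.1 hj.2]
        have := mkY_rel (YBrel.braid (d := d) (n := n) i hi.1 (by omega))
        simp only [map_mul] at this
        simp only [span_singleton_mul_span_singleton]
        exact congrArg (fun a => Submodule.span Kf {a}) this
      · rw [gLine_of_not hj]; simp only [zero_mul, mul_zero]
    · rw [gLine_of_not hi]; simp only [zero_mul, mul_zero]
  b_G_comm i h1 := by
    by_cases hi : 1 ≤ i ∧ i < n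
    · rw [gLine_of hi.1 hi.2]
      refine span_singleton_commute ?_
      have := mkY_rel (YBrel.bg (d := d) (n := n) i (by omega) (by omega))
      simp only [map_mul] at this
      exact this
    · rw [gLine_of_not hi]; exact Commute.zero_right _
  b_G_b_G := by
    by_cases hi : 1 ≤ 1 ∧ 1 < n
    · rw [gLine_of hi.1 hi.2]
      have := mkY_rel (YBrel.bgbg (d := d) (n := n))
      simp only [map_mul] at this
      simp only [span_singleton_mul_span_singleton]
      exact congrArg (fun a => Submodule.span Kf {a}) this
    · rw [gLine_of_not hi]; simp only [zero_mul, mul_zero]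

end Spanning

section GRange

variable {d n : ℕ}

theorem gRange_self (k : ℕ) : gRange d n k k = 1 := by
  simp [gRange]

theorem gRange_succ {j k : ℕ} (h : j ≤ k) :
    gRange d n j (k + 1) = gY d n k * gRange d n j k := by
  rw [gRange, gRange, show k + 1 - j = (k - j) + 1 by omega, List.range'_1_concat,
    List.reverse_append, show j + (k - j) = k by omega]
  simp only [List.reverse_singleton, List.singleton_append, List.map_cons, List.prod_cons]

theorem gRange_tY_semiconj {j k : ℕ} (hj : 1 ≤ j) (hjk : j ≤ k) (hk : k ≤ n) :
    SemiconjBy (gRange d n j k) (tY d n j) (tY d n k) := by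
  induction k, hjk using Nat.le_induction with
  | base => rw [gRange_self]; exact SemiconjBy.one_left _
  | succ k hjk ih =>
    rw [gRange_succ hjk]
    exact (gY_semiconj (by omega) (by omega)).mul_left (ih (by omega))

theorem gRange_tY_comm {i j k : ℕ} (hj : 1 ≤ j) (hjk : j ≤ k) (hk : k ≤ n)
    (hi : i < j ∨ k < i) : Commute (gRange d n j k) (tY d n i) := by
  induction k, hjk using Nat.le_induction with
  | base => rw [gRange_self]; exact Commute.one_left _
  | succ k hjk ih =>
    rw [gRange_succ hjk]
    exact (gY_tY_comm (by omega) (by omega) (by omega) (by omega)).mul_left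
      (ih (by omega) (by omega))

theorem gRange_tY_semiconj_pred {i j k : ℕ} (hj : 1 ≤ j) (hji : j < i) (hik : i ≤ k)
    (hk : k ≤ n) : SemiconjBy (gRange d n j k) (tY d n i) (tY d n (i - 1)) := by
  induction k, hik using Nat.le_induction with
  | base =>
    obtain ⟨i, rfl⟩ : ∃ l, i = l + 1 := ⟨i - 1, by omega⟩
    rw [gRange_succ (by omega)]
    exact (gY_semiconj_succ (by omega) (by omega)).mul_left
      (gRange_tY_comm hj (by omega) (by omega) (Or.inr (by omega)))
  | succ k hik ih =>
    rw [gRange_succ (by omega)]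
    have : SemiconjBy (gY d n k) (tY d n (i - 1)) (tY d n (i - 1)) :=
      gY_tY_comm (by omega) (by omega) (by omega) (by omega)
    exact this.mul_left (ih (by omega))

theorem tY_mul_eY {i : ℕ} (hi : 1 ≤ i) (hin : i < n) :
    eY d n i * tY d n i = tY d n (i + 1) * eY d n i := by
  rw [eY_eq, smul_mul_assoc, mul_smul_comm, Finset.sum_mul, Finset.mul_sum]
  congr 1
  have h1 : tY d n i ^ d = 1 := tY_pow_d hi hin.le
  have h2 : tY d n (i + 1) ^ d = 1 := tY_pow_d (by omega) hin
  have hc : Commute (tY d n i) (tY d n (i + 1)) := tY_comm _ _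
  generalize tY d n i = s at *
  generalize tY d n (i + 1) = t at *
  have e1 : ∑ m ∈ Finset.range d, s ^ m * t ^ (d - m) * s =
      ∑ m ∈ Finset.range d, s ^ (m + 1) * t ^ (d + 1 - (m + 1)) := by
    refine Finset.sum_congr rfl fun m _ => ?_
    rw [mul_assoc, ← (hc.pow_right (d - m)).eq, ← mul_assoc, ← pow_succ, Nat.add_sub_add_right]
  have e2 : ∑ m ∈ Finset.range d, t * (s ^ m * t ^ (d - m)) =
      ∑ m ∈ Finset.range d, s ^ m * t ^ (d + 1 - m) := by
    refine Finset.sum_congr rfl fun m hm => ?_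
    have := Finset.mem_range.1 hm
    rw [← mul_assoc, (hc.symm.pow_right m).eq, mul_assoc, ← pow_succ',
      show d + 1 - m = d - m + 1 by omega]
  rw [e1, e2]
  have h3 := Finset.sum_range_succ' (fun m => s ^ m * t ^ (d + 1 - m)) d
  have h4 := Finset.sum_range_succ (fun m => s ^ m * t ^ (d + 1 - m)) d
  rw [h3] at h4
  simp only [h1, pow_zero, one_mul, Nat.sub_zero, Nat.add_sub_cancel_left, pow_one, pow_succ t d,
    h2] at h4
  exact add_right_cancel h4

theorem eY_tY_comm (i j : ℕ) : Commute (eY d n i) (tY d n j) := by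
  rw [eY_eq]
  exact (Commute.sum_left _ _ _ fun m _ =>
    ((tY_comm i j).pow_left m).mul_left ((tY_comm _ j).pow_left _)).smul_left _

theorem gInv_semiconj {i : ℕ} (hi : 1 ≤ i) (hin : i < n) :
    SemiconjBy (gInv d n i) (tY d n i) (tY d n (i + 1)) := by
  have h1 := (gY_semiconj (d := d) hi hin).eq
  have h2 := tY_mul_eY (d := d) hi hin
  rw [gInv, SemiconjBy, sub_mul, mul_sub, smul_mul_assoc, mul_smul_comm, h1, h2]

theorem gInv_semiconj_succ {i : ℕ} (hi : 1 ≤ i) (hin : i < n) :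
    SemiconjBy (gInv d n i) (tY d n (i + 1)) (tY d n i) := by
  have h1 := (gY_semiconj_succ (d := d) hi hin).eq
  have h2 := tY_mul_eY (d := d) hi hin
  have h3 := (eY_tY_comm (d := d) (n := n) i (i + 1)).eq
  have h4 := (eY_tY_comm (d := d) (n := n) i i).eq
  rw [gInv, SemiconjBy, sub_mul, mul_sub, smul_mul_assoc, mul_smul_comm, h1, h3, ← h2, h4]

theorem gInv_tY_comm {i j : ℕ} (hi : 1 ≤ i) (hin : i < n) (h1 : j ≠ i) (h2 : j ≠ i + 1) :
    Commute (gInv d n i) (tY d n j) :=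
  (gY_tY_comm hi hin h1 h2).sub_left ((eY_tY_comm i j).smul_left _)

theorem bk_tY_comm {k : ℕ} (hk : k ≤ n) (j : ℕ) : Commute (bk d n k) (tY d n j) := by
  induction k using Nat.twoStepInduction generalizing j with
  | zero => exact Commute.one_left _
  | one => exact bY_tY_comm j
  | more k _ ih =>
    have ih := ih (by omega)
    have hk : k + 1 < n := by omega
    simp only [bk]
    by_cases h1 : j = k + 1
    · subst h1
      exact ((gY_semiconj_succ (by omega) hk).mul_left (ih _)).mul_left
        (gInv_semiconj (by omega) hk)
    by_cases h2 : j = k + 1 + 1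
    · subst h2
      exact ((gY_semiconj (by omega) hk).mul_left (ih _)).mul_left
        (gInv_semiconj_succ (by omega) hk)
    · exact ((gY_tY_comm (by omega) hk h1 h2).mul_left (ih _)).mul_left
        (gInv_tY_comm (by omega) hk h1 h2)

theorem exists_of_mem_Mset {k : ℕ} (hk : k < n) {x : YB d n} (hx : x ∈ Mset d n (k + 1)) :
    ∃ j m, 1 ≤ j ∧ j ≤ k + 1 ∧ (x = gRange d n j (k + 1) * tY d n j ^ m ∨
      x = gRange d n j (k + 1) * (bk d n j * tY d n j ^ m)) := by
  induction k generalizing x with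
  | zero =>
    obtain ⟨m, -, rfl | rfl⟩ := hx
    · exact ⟨1, m, le_rfl, le_rfl, Or.inl (by rw [gRange_self, one_mul])⟩
    · refine ⟨1, m, le_rfl, le_rfl, Or.inr ?_⟩
      rw [gRange_self, one_mul]
      exact ((bY_tY_comm 1).pow_right m).eq.symm
  | succ k ih =>
    rcases hx with ⟨m, -, rfl | rfl⟩ | ⟨y, hy, rfl⟩
    · exact ⟨k + 2, m, by omega, le_rfl, Or.inl (by rw [gRange_self, one_mul])⟩
    · refine ⟨k + 2, m, by omega, le_rfl, Or.inr ?_⟩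
      rw [gRange_self, one_mul]
      exact ((bk_tY_comm (by omega) _).pow_right m).eq.symm
    · obtain ⟨j, m, h1, h2, rfl | rfl⟩ := ih (by omega) hy
      · exact ⟨j, m, h1, by omega, Or.inl (by rw [gRange_succ h2, mul_assoc])⟩
      · exact ⟨j, m, h1, by omega, Or.inr (by rw [gRange_succ h2, mul_assoc])⟩

end GRange

section SpanningSets

variable {d n : ℕ}

theorem strandSpan_eq_top (hn : 1 ≤ n) :
    strandSpan (Submodule.span Kf {bY d n}) (gLine d n) (fun i => spanPow Kf (tY d n i)) n =
      ⊤ := by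
  have h := spanRel_YB d n
  set A := strandSpan (Submodule.span Kf {bY d n}) (gLine d n) (fun i => spanPow Kf (tY d n i)) n
    with hA
  have hone : (1 : YB d n) ∈ A := Submodule.one_le.1 (h.one_le_strandSpan n)
  have hmul : ∀ {p q : YB d n}, p ∈ A → q ∈ A → p * q ∈ A := fun hp hq =>
    h.strandSpan_mul_self_le n (Submodule.mul_mem_mul hp hq)
  rw [eq_top_iff]
  rintro a -
  obtain ⟨a, rfl⟩ := RingQuot.mkAlgHom_surjective Kf (YBrel d n) a
  change mkY d n a ∈ A
  induction a using FreeAlgebra.induction with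
  | grade0 r =>
    rw [AlgHom.commutes, Algebra.algebraMap_eq_smul_one]
    exact A.smul_mem r hone
  | grade1 x =>
    cases x with
    | b =>
      exact h.strandSpan_mono hn (h.murphyLine_le_strandSpan 0 (Submodule.mem_span_singleton_self _))
    | g i =>
      have hi := i.2
      have e : FreeAlgebra.ι Kf (Gen.g i) = Gg n (i + 1) := by
        rw [Gg, dif_pos ⟨by omega, by omega⟩]; rfl
      rw [e]
      refine h.strandSpan_mono (show (i : ℕ) + 1 + 1 ≤ n by omega) (h.G_le_strandSpan _ ?_)
      rw [gLine_of (by omega) (by omega)]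
      exact Submodule.mem_span_singleton_self _
    | t i =>
      have hi := i.2
      have e : FreeAlgebra.ι Kf (Gen.t i) = Tt n (i + 1) := by
        rw [Tt, dif_pos ⟨by omega, by omega⟩]; rfl
      rw [e]
      refine h.strandSpan_mono (show (i : ℕ) + 1 ≤ n by omega) (h.T_le_strandSpan _ ?_)
      have := pow_mem_spanPow (K := Kf) (tY d n (i + 1)) 1
      rw [pow_one] at this
      exact this
  | mul a b ha hb => rw [map_mul]; exact hmul ha hb
  | add a b ha hb => rw [map_add]; exact A.add_mem ha hb

theorem tY_pow_mem_Mset (hd : 1 ≤ d) {k : ℕ} (hk : k < n) (m : ℕ) :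
    tY d n (k + 1) ^ m ∈ Mset d n (k + 1) := by
  have hm : m % d ≤ d - 1 := by have := Nat.mod_lt m hd; omega
  rw [tY_pow_mod (by omega) hk]
  cases k with
  | zero => exact ⟨_, hm, Or.inl rfl⟩
  | succ k => exact Or.inl ⟨_, hm, Or.inl rfl⟩

theorem tY_pow_mul_bk_mem_Mset (hd : 1 ≤ d) {k : ℕ} (hk : k < n) (m : ℕ) :
    tY d n (k + 1) ^ m * bk d n (k + 1) ∈ Mset d n (k + 1) := by
  have hm : m % d ≤ d - 1 := by have := Nat.mod_lt m hd; omega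
  rw [tY_pow_mod (by omega) hk]
  cases k with
  | zero => exact ⟨_, hm, Or.inr rfl⟩
  | succ k => exact Or.inl ⟨_, hm, Or.inr rfl⟩

theorem strandSpan_YB_succ_le (hd : 1 ≤ d) (k : ℕ) (hk : k < n) :
    strandSpan (Submodule.span Kf {bY d n}) (gLine d n) (fun i => spanPow Kf (tY d n i)) (k + 1) ≤
      strandSpan (Submodule.span Kf {bY d n}) (gLine d n) (fun i => spanPow Kf (tY d n i)) k *
        Submodule.span Kf (Mset d n (k + 1)) := by
  refine (spanRel_YB d n).strandSpan_succ_le (β := fun k => Submodule.span Kf {bk d n k})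
    (X := fun k => Submodule.span Kf (Mset d n k)) (n := n) rfl ?_ ?_ ?_ ?_ k hk
  · intro k hk1 hkn
    obtain ⟨k, rfl⟩ : ∃ l, k = l + 1 := ⟨k - 1, by omega⟩
    have e : bk d n (k + 1 + 1) = gY d n (k + 1) * bk d n (k + 1) * gY d n (k + 1) -
        (uu - uu⁻¹) • (gY d n (k + 1) * bk d n (k + 1) * eY d n (k + 1)) := by
      rw [bk, gInv, mul_sub, mul_smul_comm]
    have hlow : (uu - uu⁻¹) • (gY d n (k + 1) * bk d n (k + 1) * eY d n (k + 1)) ∈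
        Submodule.span Kf {gY d n (k + 1)} * Submodule.span Kf {bk d n (k + 1)} *
          (spanPow Kf (tY d n (k + 1)) * spanPow Kf (tY d n (k + 1 + 1))) :=
      Submodule.smul_mem _ _ (Submodule.mul_mem_mul (Submodule.mul_mem_mul
        (Submodule.mem_span_singleton_self _) (Submodule.mem_span_singleton_self _)) (eY_mem _))
    simp only [gLine_of hk1 hkn]
    constructor
    · rw [Submodule.span_singleton_le_iff_mem, e, Submodule.add_eq_sup]
      refine Submodule.sub_mem _ (Submodule.mem_sup_left ?_) (Submodule.mem_sup_right hlow)
      exact Submodule.mul_mem_mul (Submodule.mul_mem_mul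
        (Submodule.mem_span_singleton_self _) (Submodule.mem_span_singleton_self _))
        (Submodule.mem_span_singleton_self _)
    · rw [span_singleton_mul_span_singleton, span_singleton_mul_span_singleton,
        Submodule.span_singleton_le_iff_mem, ← span_singleton_mul_span_singleton (K := Kf),
        Submodule.add_eq_sup, ← sub_add_cancel (gY d n (k + 1) * bk d n (k + 1) * gY d n (k + 1))
          ((uu - uu⁻¹) • (gY d n (k + 1) * bk d n (k + 1) * eY d n (k + 1))), ← e]
      exact Submodule.add_mem_sup (Submodule.mem_span_singleton_self _) hlow
  · intro k hk
    rw [spanPow, Submodule.span_le]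
    rintro _ ⟨m, rfl⟩
    exact Submodule.subset_span (tY_pow_mem_Mset hd hk m)
  · intro k hk
    rw [spanPow, Submodule.span_mul_span, Submodule.span_le]
    rintro _ ⟨_, ⟨m, rfl⟩, _, rfl, rfl⟩
    exact Submodule.subset_span (tY_pow_mul_bk_mem_Mset hd hk m)
  · intro k hk1 hkn
    obtain ⟨k, rfl⟩ : ∃ l, k = l + 1 := ⟨k - 1, by omega⟩
    rw [gLine_of hk1 hkn, Submodule.span_mul_span, Submodule.span_le]
    rintro _ ⟨_, rfl, x, hx, rfl⟩
    exact Submodule.subset_span (Or.inr ⟨x, hx, rfl⟩)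

/-- The set `𝖢_n` spans `Y_{d,n}^B`. -/
theorem span_Cset (hd : 1 ≤ d) (hn : 1 ≤ n) : Submodule.span Kf (Cset d n) = ⊤ := by
  rw [eq_top_iff, ← strandSpan_eq_top hn]
  suffices hs : ∀ k ≤ n, strandSpan (Submodule.span Kf {bY d n}) (gLine d n)
      (fun i => spanPow Kf (tY d n i)) k ≤ Submodule.span Kf {x | ∃ f : Fin k → YB d n,
        (∀ i : Fin k, f i ∈ Mset d n (i.val + 1)) ∧ x = (List.ofFn f).prod} from hs n le_rfl
  intro k hk
  induction k with
  | zero =>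
    refine (Submodule.one_le.2 (Submodule.subset_span ⟨Fin.elim0, fun i => i.elim0, ?_⟩))
    simp
  | succ k ih =>
    refine (strandSpan_YB_succ_le hd k hk).trans ((mul_le_mul' (ih (by omega)) le_rfl).trans ?_)
    rw [Submodule.span_mul_span, Submodule.span_le]
    rintro _ ⟨_, ⟨f, hf, rfl⟩, x, hx, rfl⟩
    refine Submodule.subset_span ⟨Fin.snoc f x, fun i => ?_, ?_⟩
    · refine Fin.lastCases ?_ (fun i => ?_) i
      · simpa using hx
      · simpa using hf i
    · simp [List.ofFn_succ', -List.ofFn_succ]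

/-- Two linear maps on `Y_{d,n+1}^B` agreeing on the products `w 𝔪` with `w ∈ Y_{d,n}^B` and
`𝔪 = g_n ⋯ g_j t_j^m` or `𝔪 = g_n ⋯ g_j b_j t_j^m` are equal. -/
theorem YB_hom_ext (hd : 1 ≤ d) (hn : 1 ≤ n) {inc : YB d n →ₐ[Kf] YB d (n + 1)}
    (hinc : IsIncl d n inc) {M : Type*} [AddCommMonoid M] [Module Kf M]
    {φ ψ : YB d (n + 1) →ₗ[Kf] M}
    (h1 : ∀ w j m, 1 ≤ j → j ≤ n + 1 →
      φ (inc w * (gRange d (n + 1) j (n + 1) * tY d (n + 1) j ^ m)) =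
        ψ (inc w * (gRange d (n + 1) j (n + 1) * tY d (n + 1) j ^ m)))
    (h2 : ∀ w j m, 1 ≤ j → j ≤ n + 1 →
      φ (inc w * (gRange d (n + 1) j (n + 1) * (bk d (n + 1) j * tY d (n + 1) j ^ m))) =
        ψ (inc w * (gRange d (n + 1) j (n + 1) * (bk d (n + 1) j * tY d (n + 1) j ^ m)))) :
    φ = ψ := by
  have hA : (⊤ : Submodule Kf (YB d (n + 1))) ≤ Subalgebra.toSubmodule inc.range *
      Submodule.span Kf (Mset d (n + 1) (n + 1)) := by
    rw [← strandSpan_eq_top (show 1 ≤ n + 1 by omega)]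
    refine (strandSpan_YB_succ_le hd n (by omega)).trans (mul_le_mul' ?_ le_rfl)
    refine (spanRel_YB d (n + 1)).strandSpan_le (n := n) ?_ ?_ ?_ ?_ ?_ n le_rfl
    · exact Submodule.one_le.2 (one_mem inc.range)
    · exact Submodule.mul_le.2 fun p hp q hq => mul_mem (S := Subalgebra _ _) hp hq
    · rw [Submodule.span_singleton_le_iff_mem]
      exact ⟨_, hinc.1⟩
    · intro k hk
      rw [spanPow, Submodule.span_le]
      rintro _ ⟨m, rfl⟩
      exact ⟨tY d n (k + 1) ^ m, by
        change inc _ = _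
        rw [map_pow, hinc.2.2 (k + 1) (by omega) hk]⟩
    · intro k hk1 hkn
      rw [gLine_of hk1 (by omega), Submodule.span_singleton_le_iff_mem]
      exact ⟨_, hinc.2.1 k hk1 (by omega)⟩
  ext a
  have ha := hA (Submodule.mem_top (x := a))
  induction ha using Submodule.mul_induction_on' with
  | mem_mul_mem p hp q hq =>
    obtain ⟨w, rfl⟩ := hp
    change φ (inc w * q) = ψ (inc w * q)
    induction hq using Submodule.span_induction with
    | mem q hq =>
      obtain ⟨j, m, hj1, hj2, rfl | rfl⟩ := exists_of_mem_Mset (by omega) hq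
      · exact h1 w j m hj1 hj2
      · exact h2 w j m hj1 hj2
    | zero => rw [mul_zero, map_zero, map_zero]
    | add p q _ _ hp hq => rw [mul_add, map_add, map_add, hp, hq]
    | smul c p _ hp => rw [mul_smul_comm, map_smul, map_smul, hp]
  | add p _ q _ hp hq => rw [map_add, map_add, hp, hq]

end SpanningSets

section RelTrace

variable {d n : ℕ} {x y : ZMod d → Kf} {inc : YB d n →ₐ[Kf] YB d (n + 1)}
  {tr : YB d (n + 1) →ₗ[Kf] YB d n}

theorem forall_of_forall_Cset (hd : 1 ≤ d) (hn : 1 ≤ n) {c : YB d (n + 1)} {c' : YB d n} {s : Kf}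
    (h : ∀ w ∈ Cset d n, tr (inc w * c) = s • (w * c')) (w : YB d n) :
    tr (inc w * c) = s • (w * c') := by
  have : tr ∘ₗ LinearMap.mulRight Kf c ∘ₗ inc.toLinearMap = s • LinearMap.mulRight Kf c' :=
    LinearMap.ext_on (span_Cset hd hn) fun w hw => h w hw
  exact LinearMap.congr_fun this w

theorem natCast_mod (m : ℕ) : ((m % d : ℕ) : ZMod d) = m := by simp

theorem mod_le_pred (hd : 1 ≤ d) (m : ℕ) : m % d ≤ d - 1 :=
  Nat.le_sub_one_of_lt (Nat.mod_lt m hd)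

namespace IsRelTrace

theorem apply_tY_pow (htr : IsRelTrace d x y n inc tr) (hd : 1 ≤ d) (hn : 1 ≤ n) (w : YB d n)
    (m : ℕ) : tr (inc w * tY d (n + 1) (n + 1) ^ m) = x m • w := by
  have h := forall_of_forall_Cset (inc := inc) (tr := tr)
    (c := tY d (n + 1) (n + 1) ^ (m % d)) (c' := 1) (s := x ((m % d : ℕ) : ZMod d)) hd hn
    (fun w hw => by rw [mul_one]; exact (htr w hw (m % d) (mod_le_pred hd m)).1) w
  rwa [← tY_pow_mod (by omega) le_rfl, natCast_mod, mul_one] at h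

theorem apply_bk_mul_tY_pow (htr : IsRelTrace d x y n inc tr) (hd : 1 ≤ d) (hn : 1 ≤ n)
    (w : YB d n) (m : ℕ) :
    tr (inc w * (bk d (n + 1) (n + 1) * tY d (n + 1) (n + 1) ^ m)) = y m • w := by
  have h := forall_of_forall_Cset (inc := inc) (tr := tr)
    (c := bk d (n + 1) (n + 1) * tY d (n + 1) (n + 1) ^ (m % d)) (c' := 1)
    (s := y ((m % d : ℕ) : ZMod d)) hd hn
    (fun w hw => by rw [mul_one]; exact (htr w hw (m % d) (mod_le_pred hd m)).2.1) w
  rwa [← tY_pow_mod (by omega) le_rfl, natCast_mod, mul_one] at h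

theorem apply_gRange_mul_tY_pow (htr : IsRelTrace d x y n inc tr) (hd : 1 ≤ d) {j : ℕ}
    (hj : 1 ≤ j) (hjn : j ≤ n) (w : YB d n) (m : ℕ) :
    tr (inc w * (gRange d (n + 1) j (n + 1) * tY d (n + 1) j ^ m)) =
      zz • (w * (gRange d n j n * tY d n j ^ m)) := by
  rw [tY_pow_mod hj (by omega), tY_pow_mod (n := n) hj hjn]
  refine forall_of_forall_Cset hd (by omega) (fun w hw => ?_) w
  have h := ((htr w hw (m % d) (mod_le_pred hd m)).2.2 j hj hjn).1
  rw [mPlus, if_neg (by omega), mPlus] at h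
  rw [h]
  split_ifs with hjn'
  · subst hjn'; rw [gRange_self, one_mul]
  · rfl

theorem apply_gRange_mul_bk_mul_tY_pow (htr : IsRelTrace d x y n inc tr) (hd : 1 ≤ d) {j : ℕ}
    (hj : 1 ≤ j) (hjn : j ≤ n) (w : YB d n) (m : ℕ) :
    tr (inc w * (gRange d (n + 1) j (n + 1) * (bk d (n + 1) j * tY d (n + 1) j ^ m))) =
      zz • (w * (gRange d n j n * (bk d n j * tY d n j ^ m))) := by
  rw [tY_pow_mod hj (by omega), tY_pow_mod (n := n) hj hjn]
  refine forall_of_forall_Cset hd (by omega) (fun w hw => ?_) w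
  have h := ((htr w hw (m % d) (mod_le_pred hd m)).2.2 j hj hjn).2
  rw [mMinus, if_neg (by omega), mMinus] at h
  rw [h]
  split_ifs with hjn'
  · subst hjn'; rw [gRange_self, one_mul, ((bk_tY_comm hjn j).pow_right _).eq]
  · rfl

/-- The relative trace is right linear over the subalgebra generated by the framings. -/
theorem apply_mul_tY (htr : IsRelTrace d x y n inc tr) (hd : 1 ≤ d) (hinc : IsIncl d n inc)
    {i : ℕ} (hi : 1 ≤ i) (hin : i ≤ n) (a : YB d (n + 1)) :
    tr (a * tY d (n + 1) i) = tr a * tY d n i := by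
  have hn : 1 ≤ n := hi.trans hin
  have hti := hinc.2.2 i hi hin
  suffices hs : tr ∘ₗ LinearMap.mulRight Kf (tY d (n + 1) i) =
      LinearMap.mulRight Kf (tY d n i) ∘ₗ tr from LinearMap.congr_fun hs a
  refine YB_hom_ext hd hn hinc (fun w j m hj hjn => ?_) (fun w j m hj hjn => ?_)
  · change tr (inc w * (gRange d (n + 1) j (n + 1) * tY d (n + 1) j ^ m) * tY d (n + 1) i) =
      tr (inc w * (gRange d (n + 1) j (n + 1) * tY d (n + 1) j ^ m)) * tY d n i
    have hc := ((tY_comm (d := d) (n := n + 1) j i).pow_left m).eq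
    have hc' := ((tY_comm (d := d) (n := n) j i).pow_left m).eq
    rcases Nat.lt_or_ge n j with hj' | hj'
    · obtain rfl : j = n + 1 := by omega
      rw [gRange_self, one_mul, mul_assoc, hc, ← mul_assoc, ← hti, ← map_mul,
        htr.apply_tY_pow hd hn, htr.apply_tY_pow hd hn, smul_mul_assoc]
    · have key : ∀ i', 1 ≤ i' → i' ≤ n →
          gRange d (n + 1) j (n + 1) * tY d (n + 1) i =
            tY d (n + 1) i' * gRange d (n + 1) j (n + 1) →
          gRange d n j n * tY d n i = tY d n i' * gRange d n j n →
          tr (inc w * (gRange d (n + 1) j (n + 1) * tY d (n + 1) j ^ m) * tY d (n + 1) i) =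
            tr (inc w * (gRange d (n + 1) j (n + 1) * tY d (n + 1) j ^ m)) * tY d n i := by
        intro i' hi1 hi2 e1 e2
        rw [mul_assoc, mul_assoc, hc, ← mul_assoc (gRange _ _ _ _), e1, mul_assoc, ← mul_assoc,
          ← hinc.2.2 i' hi1 hi2, ← map_mul, htr.apply_gRange_mul_tY_pow hd hj hj',
          htr.apply_gRange_mul_tY_pow hd hj hj', smul_mul_assoc, mul_assoc w, mul_assoc w,
          mul_assoc (gRange _ _ _ _), hc', ← mul_assoc (gRange _ _ _ _), e2, mul_assoc]
      rcases lt_trichotomy i j with h | rfl | h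
      · exact key i hi hin (gRange_tY_comm hj hjn le_rfl (Or.inl h)).eq
          (gRange_tY_comm hj hj' le_rfl (Or.inl h)).eq
      · rw [mul_assoc, mul_assoc, ← pow_succ, htr.apply_gRange_mul_tY_pow hd hj hj',
          htr.apply_gRange_mul_tY_pow hd hj hj', smul_mul_assoc, pow_succ, mul_assoc w,
          mul_assoc (gRange _ _ _ _)]
      · exact key (i - 1) (by omega) (by omega)
          (gRange_tY_semiconj_pred hj h (by omega) le_rfl).eq
          (gRange_tY_semiconj_pred hj h hin le_rfl).eq
  · change tr (inc w * (gRange d (n + 1) j (n + 1) * (bk d (n + 1) j * tY d (n + 1) j ^ m)) *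
        tY d (n + 1) i) =
      tr (inc w * (gRange d (n + 1) j (n + 1) * (bk d (n + 1) j * tY d (n + 1) j ^ m))) * tY d n i
    have hc := ((bk_tY_comm (d := d) (n := n + 1) hjn i).mul_left
      ((tY_comm (d := d) (n := n + 1) j i).pow_left m)).eq
    rcases Nat.lt_or_ge n j with hj' | hj'
    · obtain rfl : j = n + 1 := by omega
      rw [gRange_self, one_mul, mul_assoc, hc, ← mul_assoc, ← hti, ← map_mul,
        htr.apply_bk_mul_tY_pow hd hn, htr.apply_bk_mul_tY_pow hd hn, smul_mul_assoc]
    · have hc' := ((bk_tY_comm (d := d) (n := n) hj' i).mul_left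
        ((tY_comm (d := d) (n := n) j i).pow_left m)).eq
      have key : ∀ i', 1 ≤ i' → i' ≤ n →
          gRange d (n + 1) j (n + 1) * tY d (n + 1) i =
            tY d (n + 1) i' * gRange d (n + 1) j (n + 1) →
          gRange d n j n * tY d n i = tY d n i' * gRange d n j n →
          tr (inc w * (gRange d (n + 1) j (n + 1) * (bk d (n + 1) j * tY d (n + 1) j ^ m)) *
              tY d (n + 1) i) =
            tr (inc w * (gRange d (n + 1) j (n + 1) * (bk d (n + 1) j * tY d (n + 1) j ^ m))) *
              tY d n i := by
        intro i' hi1 hi2 e1 e2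
        rw [mul_assoc, mul_assoc (gRange _ _ _ _), hc, ← mul_assoc (gRange _ _ _ _), e1, mul_assoc,
          ← mul_assoc, ← hinc.2.2 i' hi1 hi2, ← map_mul,
          htr.apply_gRange_mul_bk_mul_tY_pow hd hj hj',
          htr.apply_gRange_mul_bk_mul_tY_pow hd hj hj', smul_mul_assoc, mul_assoc w, mul_assoc w,
          mul_assoc (gRange _ _ _ _), hc', ← mul_assoc (gRange d n j n) (tY d n i), e2,
            mul_assoc (tY d n i')]
      rcases lt_trichotomy i j with h | rfl | h
      · exact key i hi hin (gRange_tY_comm hj hjn le_rfl (Or.inl h)).eq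
          (gRange_tY_comm hj hj' le_rfl (Or.inl h)).eq
      · rw [mul_assoc, mul_assoc (gRange _ _ _ _), mul_assoc (bk _ _ _), ← pow_succ,
          htr.apply_gRange_mul_bk_mul_tY_pow hd hj hj',
          htr.apply_gRange_mul_bk_mul_tY_pow hd hj hj', smul_mul_assoc, pow_succ, mul_assoc w,
          mul_assoc (gRange _ _ _ _), mul_assoc (bk _ _ _)]
      · exact key (i - 1) (by omega) (by omega)
          (gRange_tY_semiconj_pred hj h (by omega) le_rfl).eq
          (gRange_tY_semiconj_pred hj h hin le_rfl).eq

theorem apply_mul_tY_pow (htr : IsRelTrace d x y n inc tr) (hd : 1 ≤ d) (hinc : IsIncl d n inc)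
    {i : ℕ} (hi : 1 ≤ i) (hin : i ≤ n) (a : YB d (n + 1)) (m : ℕ) :
    tr (a * tY d (n + 1) i ^ m) = tr a * tY d n i ^ m := by
  induction m with
  | zero => simp only [pow_zero, mul_one]
  | succ m ih => rw [pow_succ, ← mul_assoc, htr.apply_mul_tY hd hinc hi hin, ih, mul_assoc,
      ← pow_succ]

end IsRelTrace

end RelTrace

section Factorization

variable {d : ℕ}

/-- The element `∑ₘ x_{d-m} t_i^m`. -/
def framingAverage (x : ZMod d → Kf) (n i : ℕ) : YB d n :=
  ∑ m ∈ Finset.range d, x ((d - m : ℕ) : ZMod d) • tY d n i ^ m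

variable {x y : ZMod d → Kf}

theorem map_mul_framingAverage {n i : ℕ} {M : Type*} [AddCommMonoid M] [Module Kf M]
    (φ : YB d n →ₗ[Kf] M) (a : YB d n) : φ (a * framingAverage x n i) =
      ∑ m ∈ Finset.range d, x ((d - m : ℕ) : ZMod d) • φ (a * tY d n i ^ m) := by
  simp only [framingAverage, Finset.mul_sum, mul_smul_comm, map_sum, map_smul]

theorem TrT_mul_framingAverage (hd : 1 ≤ d) {E : Kf}
    (hE : ∀ k : ZMod d, ∑ m ∈ Finset.range d, x ((d - m : ℕ) : ZMod d) * x (k + m) = E * x k)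
    (hF : ∀ k : ZMod d, ∑ m ∈ Finset.range d, x ((d - m : ℕ) : ZMod d) * y (k + m) = E * y k)
    {inc : (k : ℕ) → (YB d k →ₐ[Kf] YB d (k + 1))} (hinc : ∀ k, 1 ≤ k → IsIncl d k (inc k))
    {tr1 : YB d 1 →ₗ[Kf] Kf} (htr1 : IsTr1 d x y tr1)
    {tr : (k : ℕ) → (YB d (k + 2) →ₗ[Kf] YB d (k + 1))}
    (htr : ∀ k, IsRelTrace d x y (k + 1) (inc (k + 1)) (tr k)) (n i : ℕ) (hi : 1 ≤ i)
    (hin : i ≤ n + 1) (a : YB d (n + 1)) :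
    TrT d tr1 tr n (a * framingAverage x (n + 1) i) = E * TrT d tr1 tr n a := by
  induction n generalizing i with
  | zero =>
    obtain rfl : i = 1 := by omega
    change tr1 _ = _ * tr1 _
    have hx1 : ∀ m : ℕ, tr1 (tY d 1 1 ^ m) = x m := fun m => by
      rw [tY_pow_mod le_rfl le_rfl, (htr1 _ (mod_le_pred hd m)).1, natCast_mod]
    have hy1 : ∀ m : ℕ, tr1 (bY d 1 * tY d 1 1 ^ m) = y m := fun m => by
      rw [tY_pow_mod le_rfl le_rfl, (htr1 _ (mod_le_pred hd m)).2, natCast_mod]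
    suffices hs : tr1 ∘ₗ LinearMap.mulRight Kf (framingAverage x (0 + 1) 1) = E • tr1 from
      LinearMap.congr_fun hs a
    refine LinearMap.ext_on (span_Cset hd le_rfl) fun w hw => ?_
    change tr1 (w * _) = E * tr1 w
    obtain ⟨f, hf, rfl⟩ := hw
    have hw := hf 0
    simp only [List.ofFn_succ, List.ofFn_zero, List.prod_cons, List.prod_nil, mul_one]
    rw [map_mul_framingAverage]
    obtain ⟨k, -, h | h⟩ := hw
    · rw [h, hx1, ← hE]
      refine Finset.sum_congr rfl fun m _ => ?_
      rw [← pow_add, hx1, Nat.cast_add, smul_eq_mul]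
    · rw [h, ← ((bY_tY_comm 1).pow_right k).eq, hy1, ← hF]
      refine Finset.sum_congr rfl fun m _ => ?_
      rw [mul_assoc, ← pow_add, hy1, Nat.cast_add, smul_eq_mul]
  | succ n ih =>
    have hincn := hinc (n + 1) (by omega)
    have htrn := htr n
    have hn : 1 ≤ n + 1 := by omega
    change TrT d tr1 tr n (tr n _) = E * TrT d tr1 tr n (tr n a)
    rcases Nat.lt_or_ge (n + 1) i with hi' | hi'
    · obtain rfl : i = n + 1 + 1 := by omega
      suffices hs : TrT d tr1 tr n ∘ₗ tr n ∘ₗ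
          LinearMap.mulRight Kf (framingAverage x (n + 1 + 1) (n + 1 + 1)) =
          E • (TrT d tr1 tr n ∘ₗ tr n) from LinearMap.congr_fun hs a
      refine YB_hom_ext hd hn hincn (fun w j k hj hjn => ?_) (fun w j k hj hjn => ?_)
      · change TrT d tr1 tr n (tr n (inc (n + 1) w * (gRange d (n + 1 + 1) j (n + 1 + 1) *
          tY d (n + 1 + 1) j ^ k) * _)) = E * TrT d tr1 tr n (tr n (inc (n + 1) w *
          (gRange d (n + 1 + 1) j (n + 1 + 1) * tY d (n + 1 + 1) j ^ k)))
        rw [map_mul_framingAverage]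
        rcases Nat.lt_or_ge (n + 1) j with hj' | hj'
        · obtain rfl : j = n + 1 + 1 := by omega
          simp only [gRange_self, one_mul, mul_assoc, ← pow_add, htrn.apply_tY_pow hd hn, map_sum,
            map_smul, smul_eq_mul, Nat.cast_add]
          simp only [← mul_assoc, ← Finset.sum_mul]
          rw [← hE]
        · rw [htrn.apply_gRange_mul_tY_pow hd hj hj', ← ih j hj hj', map_mul_framingAverage, map_sum]
          refine Finset.sum_congr rfl fun m _ => ?_
          have e1 := ((gRange_tY_semiconj_pred (d := d) hj (show j < n + 1 + 1 by omega) le_rfl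
            le_rfl).pow_right m).eq
          have e2 := ((gRange_tY_semiconj (d := d) hj hj' le_rfl).pow_right m).eq
          have hc := ((tY_comm (d := d) (n := n + 1 + 1) j (n + 1 + 1)).pow_pow k m).eq
          have hc' := ((tY_comm (d := d) (n := n + 1) j j).pow_pow k m).eq
          rw [Nat.add_sub_cancel] at e1
          rw [map_smul, mul_assoc, mul_assoc (gRange _ _ _ _), hc, ← mul_assoc (gRange _ _ _ _), e1,
            mul_assoc (tY _ _ _ ^ m), ← mul_assoc, ← hincn.2.2 (n + 1) (by omega) le_rfl, ← map_pow,
            ← map_mul, htrn.apply_gRange_mul_tY_pow hd hj hj', smul_mul_assoc, mul_assoc w,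
            mul_assoc w, mul_assoc (gRange _ _ _ _), hc', ← mul_assoc (gRange _ _ _ _), e2,
            mul_assoc (tY _ _ _ ^ m)]
      · change TrT d tr1 tr n (tr n (inc (n + 1) w * (gRange d (n + 1 + 1) j (n + 1 + 1) *
          (bk d (n + 1 + 1) j * tY d (n + 1 + 1) j ^ k)) * _)) =
          E * TrT d tr1 tr n (tr n (inc (n + 1) w * (gRange d (n + 1 + 1) j (n + 1 + 1) *
          (bk d (n + 1 + 1) j * tY d (n + 1 + 1) j ^ k))))
        rw [map_mul_framingAverage]
        rcases Nat.lt_or_ge (n + 1) j with hj' | hj'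
        · obtain rfl : j = n + 1 + 1 := by omega
          simp only [gRange_self, one_mul, mul_assoc, ← pow_add, htrn.apply_bk_mul_tY_pow hd hn,
            map_sum, map_smul, smul_eq_mul, Nat.cast_add]
          simp only [← mul_assoc, ← Finset.sum_mul]
          rw [← hF]
        · rw [htrn.apply_gRange_mul_bk_mul_tY_pow hd hj hj', ← ih j hj hj', map_mul_framingAverage,
            map_sum]
          refine Finset.sum_congr rfl fun m _ => ?_
          have e1 := ((gRange_tY_semiconj_pred (d := d) hj (show j < n + 1 + 1 by omega) le_rfl
            le_rfl).pow_right m).eq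
          have e2 := ((gRange_tY_semiconj (d := d) hj hj' le_rfl).pow_right m).eq
          have hc := (((bk_tY_comm (d := d) hjn (n + 1 + 1)).pow_right m).mul_left
            ((tY_comm (d := d) (n := n + 1 + 1) j (n + 1 + 1)).pow_pow k m)).eq
          have hc' := (((bk_tY_comm (d := d) hj' j).pow_right m).mul_left
            ((tY_comm (d := d) (n := n + 1) j j).pow_pow k m)).eq
          rw [Nat.add_sub_cancel] at e1
          rw [map_smul, mul_assoc, mul_assoc (gRange _ _ _ _), hc, ← mul_assoc (gRange _ _ _ _), e1,
            mul_assoc (tY _ _ _ ^ m), ← mul_assoc, ← hincn.2.2 (n + 1) (by omega) le_rfl, ← map_pow,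
            ← map_mul, htrn.apply_gRange_mul_bk_mul_tY_pow hd hj hj', smul_mul_assoc, mul_assoc w,
            mul_assoc w, mul_assoc (gRange _ _ _ _), hc',
            ← mul_assoc (gRange d (n + 1) j (n + 1)) (tY d (n + 1) j ^ m), e2,
            mul_assoc (tY _ _ _ ^ m)]
    · rw [← ih i hi hi', map_mul_framingAverage, map_mul_framingAverage, map_sum]
      simp only [map_smul, htrn.apply_mul_tY_pow hd hincn hi hi']

theorem TrT_one (hd : 1 ≤ d) (hx0 : x 0 = 1)
    {inc : (k : ℕ) → (YB d k →ₐ[Kf] YB d (k + 1))}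
    {tr1 : YB d 1 →ₗ[Kf] Kf} (htr1 : IsTr1 d x y tr1)
    {tr : (k : ℕ) → (YB d (k + 2) →ₗ[Kf] YB d (k + 1))}
    (htr : ∀ k, IsRelTrace d x y (k + 1) (inc (k + 1)) (tr k)) (n : ℕ) :
    TrT d tr1 tr n 1 = 1 := by
  induction n with
  | zero =>
    have := (htr1 0 (Nat.zero_le _)).1
    rwa [pow_zero, Nat.cast_zero, hx0] at this
  | succ n ih =>
    have := (htr n).apply_tY_pow hd (by omega) 1 0
    rw [map_one, one_mul, pow_zero, Nat.cast_zero, hx0, one_smul] at this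
    change TrT d tr1 tr n (tr n 1) = 1
    rw [this, ih]

theorem IsRelTrace.apply_mul_eY {n : ℕ} {inc : YB d n →ₐ[Kf] YB d (n + 1)}
    {tr : YB d (n + 1) →ₗ[Kf] YB d n} (htr : IsRelTrace d x y n inc tr) (hd : 1 ≤ d) (hn : 1 ≤ n)
    (hinc : IsIncl d n inc) (w : YB d n) :
    tr (inc w * eY d (n + 1) n) = (d : Kf)⁻¹ • (w * framingAverage x n n) := by
  rw [eY_eq, mul_smul_comm, map_smul, Finset.mul_sum, map_sum, framingAverage, Finset.mul_sum]
  congr 1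
  refine Finset.sum_congr rfl fun m _ => ?_
  rw [← mul_assoc, ← hinc.2.2 n hn le_rfl, ← map_pow, ← map_mul, htr.apply_tY_pow hd hn,
    mul_smul_comm]

end Factorization


/-- if the trace parameters are specialized to complex numbers
`(x_1, …, x_{d-1})` satisfying the E-condition and `(y_0, …, y_{d-1})` satisfying the
F-condition with respect to the `x`'s, then for every `n ≥ 1` (here `n = m + 1`) and every
`w ∈ Y_{d,n}^B`, `Tr_{n+1}(w e_n) = Tr_n(w) · Tr_{n+1}(e_n)`. -/
theorem stmt18 (d : ℕ) (hd : 1 ≤ d)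
    (x y : ZMod d → ℂ) (hx0 : x 0 = 1) (hx : ∀ i, x i ≠ 0) (hy : ∀ i, y i ≠ 0)
    (hE : ∀ k : ZMod d, k ≠ 0 →
      (d : ℂ)⁻¹ * ∑ m ∈ Finset.range d, x (k + (m : ZMod d)) * x (((d - m : ℕ) : ZMod d)) =
      x k * ((d : ℂ)⁻¹ * ∑ m ∈ Finset.range d,
        x ((m : ZMod d)) * x (((d - m : ℕ) : ZMod d))))
    (hF : ∀ k : ZMod d,
      (d : ℂ)⁻¹ * ∑ m ∈ Finset.range d, x (((d - m : ℕ) : ZMod d)) * y (k + (m : ZMod d)) =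
      y k * ((d : ℂ)⁻¹ * ∑ m ∈ Finset.range d,
        x ((m : ZMod d)) * x (((d - m : ℕ) : ZMod d))))
    (inc : (k : ℕ) → (YB d k →ₐ[Kf] YB d (k + 1))) (hinc : ∀ k, 1 ≤ k → IsIncl d k (inc k))
    (tr1 : YB d 1 →ₗ[Kf] Kf)
    (htr1 : IsTr1 d (fun i => CtoL (x i)) (fun i => CtoL (y i)) tr1)
    (tr : (k : ℕ) → (YB d (k + 2) →ₗ[Kf] YB d (k + 1)))
    (htr : ∀ k, IsRelTrace d (fun i => CtoL (x i)) (fun i => CtoL (y i)) (k + 1)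
      (inc (k + 1)) (tr k)) :
    ∀ (m : ℕ) (w : YB d (m + 1)),
      TrT d tr1 tr (m + 1) (inc (m + 1) w * eY d (m + 2) (m + 1)) =
        TrT d tr1 tr m w * TrT d tr1 tr (m + 1) (eY d (m + 2) (m + 1)) := by
  have hd0 : (d : ℂ) ≠ 0 := Nat.cast_ne_zero.2 (by omega)
  set E : ℂ := ∑ m ∈ Finset.range d, x (m : ZMod d) * x ((d - m : ℕ) : ZMod d) with hEdef
  have hE' : ∀ k : ZMod d, ∑ m ∈ Finset.range d,
      CtoL (x ((d - m : ℕ) : ZMod d)) * CtoL (x (k + m)) = CtoL E * CtoL (x k) := fun k => by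
    simp only [← map_mul, ← map_sum]
    congr 1
    by_cases hk : k = 0
    · subst hk
      rw [hx0, mul_one]
      exact Finset.sum_congr rfl fun m _ => by rw [zero_add, mul_comm]
    · have h := hE k hk
      rw [mul_left_comm] at h
      have h' := mul_left_cancel₀ (inv_ne_zero hd0) h
      rw [mul_comm E, ← h']
      exact Finset.sum_congr rfl fun m _ => mul_comm _ _
  have hF' : ∀ k : ZMod d, ∑ m ∈ Finset.range d,
      CtoL (x ((d - m : ℕ) : ZMod d)) * CtoL (y (k + m)) = CtoL E * CtoL (y k) := fun k => by
    simp only [← map_mul, ← map_sum]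
    congr 1
    have h := hF k
    rw [mul_left_comm] at h
    rw [mul_comm E]
    exact mul_left_cancel₀ (inv_ne_zero hd0) h
  intro m w
  have key : ∀ w : YB d (m + 1), TrT d tr1 tr (m + 1) (inc (m + 1) w * eY d (m + 2) (m + 1)) =
      (d : Kf)⁻¹ * (CtoL E * TrT d tr1 tr m w) := fun w => by
    change TrT d tr1 tr m (tr m _) = _
    rw [(htr m).apply_mul_eY hd (by omega) (hinc (m + 1) (by omega)), map_smul, smul_eq_mul,
      TrT_mul_framingAverage hd hE' hF' hinc htr1 htr m (m + 1) (by omega) le_rfl]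
  have h1 := key 1
  rw [map_one, one_mul, TrT_one hd (by simp only [hx0, map_one]) htr1 htr] at h1
  rw [key, h1]
  ring
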